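/- arXiv:1607.08648 — 4 statements merged into one kernel-verified Lean document; each statement's English description precedes it below -/
import Mathlib

section
/- The set of triples (x, y, z) of Gaussian integers with xyz ≠ 0, gcd(x, y, z) a unit, and x^4 + y^4 = i·z^2 is finite. -/
open Zsqrtd

local notation "𝕃" => (⟨1, 1⟩ : GaussianInt)
local notation "𝕚" => (⟨0, 1⟩ : GaussianInt)

lemma gi_par (a : GaussianInt) : (∃ m, a = 𝕃 * m) ∨ (∃ m, a = 1 + 𝕃 * m) := by
  obtain ⟨x, y⟩ := a
  rcases Int.even_or_odd' (x + y) with ⟨k, hk | hk⟩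
  · left; refine ⟨⟨k, k - x⟩, ?_⟩
    ext <;> simp <;> lia
  · right; refine ⟨⟨k, k + 1 - x⟩, ?_⟩
    ext <;> simp <;> lia

lemma gi_not (a : GaussianInt) (h : 𝕃 ∣ a) (h1 : 𝕃 ∣ a - 1) : False := by
  have : 𝕃 ∣ 1 := by simpa using dvd_sub h h1
  obtain ⟨⟨x, y⟩, h⟩ := this
  rw [Zsqrtd.ext_iff] at h
  simp at h
  lia

lemma LL : 𝕃 * 𝕃 = 2 * 𝕚 := by decide
lemma ii : 𝕚 * 𝕚 = -1 := by decide

/-- odd elements are `1` or `i` modulo `2` -/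
lemma gi_odd {a : GaussianInt} (h : 𝕃 ∣ a - 1) : (∃ m, a = 1 + 2 * m) ∨ ∃ m, a = 𝕚 + 2 * m := by
  obtain ⟨m, hm⟩ := h
  rcases gi_par m with ⟨n, hn⟩ | ⟨n, hn⟩
  · left; refine ⟨𝕚 * n, ?_⟩
    linear_combination hm + 𝕃 * hn + n * LL
  · right; refine ⟨1 + 𝕚 * n, ?_⟩
    have : 𝕃 = 1 + 𝕚 := by decide
    linear_combination hm + 𝕃 * hn + n * LL + this

lemma gi_sq {a : GaussianInt} (h : 𝕃 ∣ a - 1) : (∃ m, a ^ 2 = 1 + 4 * m) ∨ ∃ m, a ^ 2 = -1 + 4 * m := by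
  rcases gi_odd h with ⟨m, rfl⟩ | ⟨m, rfl⟩
  · left; exact ⟨m + m ^ 2, by ring⟩
  · right; exact ⟨𝕚 * m + m ^ 2, by linear_combination ii⟩

lemma gi_four {a : GaussianInt} (h : 𝕃 ∣ a - 1) : ∃ m, a ^ 4 = 1 + 4 * m := by
  rcases gi_sq h with ⟨m, hm⟩ | ⟨m, hm⟩
  · exact ⟨2 * m + 4 * m ^ 2, by linear_combination (a ^ 2 + 1 + 4 * m) * hm⟩
  · exact ⟨-2 * m + 4 * m ^ 2, by linear_combination (a ^ 2 - 1 + 4 * m) * hm⟩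

lemma gi_four_even {a : GaussianInt} (h : 𝕃 ∣ a) : ∃ m, a ^ 4 = 4 * m := by
  obtain ⟨m, rfl⟩ := h
  have : 𝕃 ^ 4 = -4 := by decide
  exact ⟨-m ^ 4, by linear_combination m ^ 4 * this⟩

lemma gi_par' (a : GaussianInt) : 𝕃 ∣ a ∨ 𝕃 ∣ a - 1 := by
  rcases gi_par a with ⟨m, h⟩ | ⟨m, h⟩
  · exact Or.inl ⟨m, h⟩
  · exact Or.inr ⟨m, by rw [h]; ring⟩

lemma odd_mul {a b : GaussianInt} (ha : 𝕃 ∣ a - 1) (hb : 𝕃 ∣ b - 1) : 𝕃 ∣ a * b - 1 := by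
  have : a * b - 1 = (a - 1) * b + (b - 1) := by ring
  rw [this]; exact dvd_add (ha.mul_right _) hb

lemma odd_of_dvd {a b : GaussianInt} (hb : 𝕃 ∣ b - 1) (h : a ∣ b) : 𝕃 ∣ a - 1 := by
  rcases gi_par' a with h' | h'
  · exact (gi_not b (h'.trans h) hb).elim
  · exact h'

lemma odd_imul {a : GaussianInt} (ha : 𝕃 ∣ a - 1) : 𝕃 ∣ 𝕚 * a - 1 :=
  odd_mul ⟨𝕚, by decide⟩ ha

lemma not_sq_i {a m : GaussianInt} (ha : 𝕃 ∣ a - 1) (h : a ^ 2 = 𝕚 + 4 * m) : False := by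
  rcases gi_sq ha with ⟨n, hn⟩ | ⟨n, hn⟩ <;>
  · rw [h] at hn
    have := congrArg Zsqrtd.im hn
    simp at this
    lia

lemma not_sq_negi {a m : GaussianInt} (ha : 𝕃 ∣ a - 1) (h : a ^ 2 = -𝕚 + 4 * m) : False := by
  rcases gi_sq ha with ⟨n, hn⟩ | ⟨n, hn⟩ <;>
  · rw [h] at hn
    have := congrArg Zsqrtd.im hn
    simp at this
    lia

lemma gi_unit {u : GaussianInt} (h : IsUnit u) : u = 1 ∨ u = -1 ∨ u = 𝕚 ∨ u = -𝕚 := by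
  rw [← Zsqrtd.norm_eq_one_iff' (by norm_num)] at h
  obtain ⟨x, y⟩ := u
  simp [Zsqrtd.norm] at h
  have : -1 ≤ x := by nlinarith
  have : x ≤ 1 := by nlinarith
  have : -1 ≤ y := by nlinarith
  have : y ≤ 1 := by nlinarith
  interval_cases x <;> interval_cases y <;> simp at h <;> decide

lemma gi_unit4 {u : GaussianInt} (h : IsUnit u) : u ^ 4 = 1 := by
  rcases gi_unit h with rfl | rfl | rfl | rfl <;> decide

lemma sum_i {p q x : GaussianInt} (hx : 𝕃 ∣ x - 1) (h : p ^ 4 + q ^ 4 = 𝕚 * x ^ 2) : False := by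
  have key : x ^ 2 = - 𝕚 * (p ^ 4 + q ^ 4) := by
    linear_combination 𝕚 * h + x ^ 2 * ii
  rcases gi_par' p with hp | hp <;> rcases gi_par' q with hq | hq
  · have h1 : 𝕃 ∣ x ^ 2 := by
      rw [key]
      exact (dvd_add (dvd_pow hp (by norm_num)) (dvd_pow hq (by norm_num))).mul_left _
    exact gi_not _ h1 (by rw [pow_two]; exact odd_mul hx hx)
  · obtain ⟨m, hm⟩ := gi_four_even hp
    obtain ⟨n, hn⟩ := gi_four hq
    exact not_sq_negi (m := -𝕚 * (m + n)) hx (by rw [key, hm, hn]; ring)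
  · obtain ⟨m, hm⟩ := gi_four hp
    obtain ⟨n, hn⟩ := gi_four_even hq
    exact not_sq_negi (m := -𝕚 * (m + n)) hx (by rw [key, hm, hn]; ring)
  · obtain ⟨m, hm⟩ := gi_four hp
    obtain ⟨n, hn⟩ := gi_four hq
    have h1 : 𝕃 ∣ x ^ 2 := by
      rw [key, hm, hn]
      exact ⟨⟨1, -1⟩ * (- 𝕚 * (1 + 2 * m + 2 * n)), by
        have : 𝕃 * ⟨1, -1⟩ = 2 := by decide
        linear_combination (𝕚 * (1 + 2 * m + 2 * n)) * this⟩
    exact gi_not _ h1 (by rw [pow_two]; exact odd_mul hx hx)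

lemma desc_step (k : ℕ)
    (ih : ∀ x y w : GaussianInt, IsCoprime x y → 𝕃 ∣ w - 1 → x ^ 4 - y ^ 4 = w ^ 2 → 𝕃 ^ k ∣ x * y)
    (x y w : GaussianInt) (hc : IsCoprime x y) (hw : 𝕃 ∣ w - 1) (hx : 𝕃 ∣ x - 1) (hy : 𝕃 ∣ y)
    (h : x ^ 4 - y ^ 4 = w ^ 2) : 𝕃 ^ (k + 1) ∣ y := by
  obtain ⟨y1, rfl⟩ := hy
  have L4 : 𝕃 ^ 4 = -4 := by decide
  have two0 : (2 : GaussianInt) ≠ 0 := by decide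
  obtain ⟨s, hs⟩ : ∃ s, x ^ 2 = 1 + 2 * s := by
    rcases gi_sq hx with ⟨m, hm⟩ | ⟨m, hm⟩
    · exact ⟨2 * m, by linear_combination hm⟩
    · exact ⟨2 * m - 1, by linear_combination hm⟩
  obtain ⟨t, ht⟩ : ∃ t, w = 1 + 2 * t := by
    rcases gi_odd hw with h1 | ⟨t, ht⟩
    · exact h1
    · exfalso
      obtain ⟨m, hm⟩ := gi_four hx
      have e : (1 : GaussianInt) + 4 * m + 4 * y1 ^ 4 = -1 + 4 * (𝕚 * t + t ^ 2) := by
        linear_combination h - hm + y1 ^ 4 * L4 + (w + 𝕚 + 2 * t) * ht + ii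
      have := congrArg Zsqrtd.re e
      simp at this
      lia
  obtain ⟨A, hA⟩ : ∃ A, A = s - t := ⟨_, rfl⟩
  obtain ⟨B, hB⟩ : ∃ B, B = 1 + s + t := ⟨_, rfl⟩
  have hAB : A + B = x ^ 2 := by rw [hA, hB, hs]; ring
  have hBA : B - A = w := by rw [hA, hB, ht]; ring
  have hprod : A * (-B) = y1 ^ 4 := by
    have : (2 * 2) * (A * (-B)) = (2 * 2) * y1 ^ 4 := by
      linear_combination -(A + B + x ^ 2) * hAB + (B - A + w) * hBA - h - y1 ^ 4 * L4
    exact mul_left_cancel₀ (mul_ne_zero two0 two0) this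
  have hc1 : IsCoprime x y1 := hc.of_mul_right_right
  have hcAB : IsCoprime A (-B) := by
    have h1 : IsCoprime (A + B) (A * (-B)) := by
      rw [hAB, hprod]; exact hc1.pow
    have h2 := h1.of_mul_right_left
    have h3 : IsCoprime B A := by
      obtain ⟨a, b, e⟩ := h2
      exact ⟨a, a + b, by linear_combination e⟩
    exact h3.symm.neg_right
  obtain ⟨p, u, hp⟩ := exists_associated_pow_of_mul_eq_pow' hcAB hprod
  obtain ⟨q, v, hq⟩ := exists_associated_pow_of_mul_eq_pow' hcAB.symm ((mul_comm _ _).trans hprod)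
  have hpq : (p * q) ^ 4 ∣ y1 ^ 4 := ⟨u * v, by rw [← hprod, ← hp, ← hq]; ring⟩
  have hpq' : p * q ∣ y1 := by
    exact (IsIntegrallyClosed.pow_dvd_pow_iff (by norm_num)).1 hpq
  have hcpq : IsCoprime p q := by
    rw [← hp, ← hq] at hcAB
    exact IsCoprime.pow_iff (by norm_num) (by norm_num) |>.1
      (hcAB.of_mul_left_left.of_mul_right_left)
  suffices h𝕃 : 𝕃 ^ k ∣ p * q by
    rw [pow_succ']
    exact mul_dvd_mul_left _ (h𝕃.trans hpq')
  by_cases hy0 : y1 = 0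
  · have : p * q = 0 := by
      have h0 : (p * q) ^ 4 * ((u : GaussianInt) * v) = 0 := by
        have : (p * q) ^ 4 * ((u : GaussianInt) * v) = y1 ^ 4 := by
          rw [← hprod, ← hp, ← hq]; ring
        rw [this, hy0]; norm_num
      rcases mul_eq_zero.1 h0 with h1 | h1
      · exact pow_eq_zero_iff (by norm_num) |>.1 h1
      · exact absurd h1 (mul_ne_zero u.ne_zero v.ne_zero)
    rw [this]; exact dvd_zero _
  obtain ⟨r, hr⟩ := hpq'
  have huv : (u : GaussianInt) * v = r ^ 4 := by
    have h0 : (p * q) ^ 4 ≠ 0 := by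
      intro h0
      apply hy0
      rw [hr, pow_eq_zero_iff (by norm_num) |>.1 h0, zero_mul]
    apply mul_left_cancel₀ h0
    rw [← mul_pow, ← hr, ← hprod, ← hp, ← hq]; ring
  have hru : IsUnit r := by
    have : IsUnit (r ^ 4) := by rw [← huv]; exact u.isUnit.mul v.isUnit
    exact (isUnit_pow_iff (by norm_num)).1 this
  rw [gi_unit4 hru] at huv
  have hx2 : (u : GaussianInt) * p ^ 4 - v * q ^ 4 = x ^ 2 := by
    linear_combination hAB + hp - hq
  rcases gi_unit u.isUnit with hu | hu | hu | hu
  · have hv : (v : GaussianInt) = 1 := by rw [hu] at huv; simpa using huv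
    rw [hu, hv] at hx2
    exact ih p q x hcpq hx (by linear_combination hx2)
  · have hv : (v : GaussianInt) = -1 := by rw [hu] at huv; linear_combination -huv
    rw [hu, hv] at hx2
    exact ih p q (𝕚 * x) hcpq (odd_imul hx) (by linear_combination -hx2 - x ^ 2 * ii)
  · have hv : (v : GaussianInt) = -𝕚 := by
      rw [hu] at huv; linear_combination -𝕚 * huv + v * ii
    rw [hu, hv] at hx2
    exact (sum_i (p := p) (q := q) (odd_imul hx)
      (by linear_combination -𝕚 * hx2 + (p ^ 4 + q ^ 4 - 𝕚 * x ^ 2) * ii)).elim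
  · have hv : (v : GaussianInt) = 𝕚 := by
      rw [hu] at huv; linear_combination 𝕚 * huv + v * ii
    rw [hu, hv] at hx2
    exact (sum_i (p := p) (q := q) hx
      (by linear_combination 𝕚 * hx2 + (p ^ 4 + q ^ 4) * ii)).elim

lemma desc (k : ℕ) : ∀ x y w : GaussianInt, IsCoprime x y → 𝕃 ∣ w - 1 →
    x ^ 4 - y ^ 4 = w ^ 2 → 𝕃 ^ k ∣ x * y := by
  induction k with
  | zero => intros; simp
  | succ k ih =>
    intro x y w hc hw h
    have hw2 : 𝕃 ∣ w ^ 2 - 1 := by rw [pow_two]; exact odd_mul hw hw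
    have f {a : GaussianInt} (ha : 𝕃 ∣ a) : 𝕃 ∣ a ^ 4 := dvd_pow ha (by norm_num)
    have g {a : GaussianInt} (ha : 𝕃 ∣ a - 1) : 𝕃 ∣ a ^ 4 - 1 :=
      ha.trans (sub_one_dvd_pow_sub_one a _)
    rcases gi_par' x with hx | hx <;> rcases gi_par' y with hy | hy
    · exact (gi_not (w ^ 2) (by rw [← h]; exact dvd_sub (f hx) (f hy)) hw2).elim
    · exact (desc_step k ih y x (𝕚 * w) hc.symm (odd_imul hw) hy hx
        (by linear_combination -h - w ^ 2 * ii)).mul_right _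
    · exact (desc_step k ih x y w hc hw hx hy h).mul_left _
    · exact (gi_not (w ^ 2) (by
        rw [← h]; simpa using dvd_sub (g hx) (g hy)) hw2).elim

lemma no_sol {x y w : GaussianInt} (hc : IsCoprime x y) (hw : 𝕃 ∣ w - 1)
    (h : x ^ 4 - y ^ 4 = w ^ 2) : x * y = 0 := by
  by_contra h0
  have : FiniteMultiplicity 𝕃 (x * y) := by
    refine FiniteMultiplicity.of_not_isUnit (fun hu => ?_) h0
    exact gi_not 1 hu.dvd (by simp)
  obtain ⟨n, hn⟩ := this
  exact hn (desc _ x y w hc hw h)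

lemma main_units {x y z : GaussianInt} (hd : ∀ d : GaussianInt, d ∣ x → d ∣ y → d ∣ z → IsUnit d)
    (h : x ^ 4 + y ^ 4 = 𝕚 * z ^ 2) : x ^ 4 = y ^ 4 ∧ IsCoprime x y := by
  have L2 : 𝕃 ^ 2 = 2 * 𝕚 := by decide
  have two0 : (2 : GaussianInt) ≠ 0 := by decide
  have hc : IsCoprime x y := by
    rw [← EuclideanDomain.gcd_isUnit_iff]
    set d := EuclideanDomain.gcd x y
    have h1 : d ∣ x := EuclideanDomain.gcd_dvd_left _ _
    have h2 : d ∣ y := EuclideanDomain.gcd_dvd_right _ _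
    refine hd d h1 h2 ?_
    have h3 : d ^ 4 ∣ z ^ 2 := by
      have e : z ^ 2 = -𝕚 * (x ^ 4 + y ^ 4) := by linear_combination 𝕚 * h + z ^ 2 * ii
      rw [e]
      exact (dvd_add (pow_dvd_pow_of_dvd h1 4) (pow_dvd_pow_of_dvd h2 4)).mul_left _
    exact (IsIntegrallyClosed.pow_dvd_pow_iff (n := 2) (by norm_num)).1 ((pow_dvd_pow d (by norm_num)).trans h3)
  refine ⟨?_, hc⟩
  have hz : 𝕃 ∣ z := by
    rcases gi_par' z with hz | hz
    · exact hz
    · exact (sum_i hz h).elim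
  obtain ⟨m, rfl⟩ := hz
  have hs : x ^ 4 + y ^ 4 = -2 * m ^ 2 := by
    linear_combination h + m ^ 2 * 𝕚 * L2 + 2 * m ^ 2 * ii
  have L2d : 𝕃 ∣ 2 := ⟨⟨1, -1⟩, by decide⟩
  have hsd : 𝕃 ∣ x ^ 4 + y ^ 4 := by
    rw [hs]; exact (dvd_neg.2 L2d).mul_right _
  have f {a : GaussianInt} (ha : 𝕃 ∣ a) : 𝕃 ∣ a ^ 4 := dvd_pow ha (by norm_num)
  have g {a : GaussianInt} (ha : 𝕃 ∣ a - 1) : 𝕃 ∣ a ^ 4 - 1 :=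
    ha.trans (sub_one_dvd_pow_sub_one a _)
  have hxy : 𝕃 ∣ x - 1 ∧ 𝕃 ∣ y - 1 := by
    rcases gi_par' x with hx | hx <;> rcases gi_par' y with hy | hy
    · have := hc.isUnit_of_dvd' hx hy
      exact (gi_not 1 this.dvd (by simp)).elim
    · refine (gi_not _ hsd ?_).elim
      rw [add_sub_assoc]; exact dvd_add (f hx) (g hy)
    · refine (gi_not _ hsd ?_).elim
      rw [add_comm, add_sub_assoc]; exact dvd_add (f hy) (g hx)
    · exact ⟨hx, hy⟩
  obtain ⟨hx, hy⟩ := hxy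
  obtain ⟨s, hs1⟩ : ∃ s, x ^ 2 = 1 + 2 * s := by
    rcases gi_sq hx with ⟨m, hm⟩ | ⟨m, hm⟩
    · exact ⟨2 * m, by linear_combination hm⟩
    · exact ⟨2 * m - 1, by linear_combination hm⟩
  obtain ⟨t, ht1⟩ : ∃ s, y ^ 2 = 1 + 2 * s := by
    rcases gi_sq hy with ⟨m, hm⟩ | ⟨m, hm⟩
    · exact ⟨2 * m, by linear_combination hm⟩
    · exact ⟨2 * m - 1, by linear_combination hm⟩
  obtain ⟨A, hA⟩ : ∃ A, A = 1 + s + t := ⟨_, rfl⟩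
  obtain ⟨B, hB⟩ : ∃ B, B = s - t := ⟨_, rfl⟩
  have e1 : A + B = x ^ 2 := by rw [hs1, hA, hB]; ring
  have e2 : A - B = y ^ 2 := by rw [ht1, hA, hB]; ring
  have e3 : A ^ 2 + B ^ 2 = - m ^ 2 := by
    apply mul_left_cancel₀ two0
    linear_combination (A + B + x ^ 2) * e1 + (A - B + y ^ 2) * e2 + hs
  have hx2 : 𝕃 ∣ x ^ 2 - 1 := hx.trans (sub_one_dvd_pow_sub_one x _)
  have hm : 𝕃 ∣ m - 1 := by
    rcases gi_par' m with hm | hm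
    · exfalso
      have : 𝕃 ∣ x ^ 4 := by
        have e : x ^ 4 = -m ^ 2 + 2 * (A * B) := by
          linear_combination -(A + B + x ^ 2) * e1 + e3
        rw [e]
        exact dvd_add (dvd_neg.2 (dvd_pow hm (by norm_num))) (L2d.mul_right _)
      exact gi_not _ this (g hx)
    · exact hm
  have hcAB : IsCoprime A B := by
    have h1 : IsCoprime (A + B) (A - B) := by rw [e1, e2]; exact hc.pow
    obtain ⟨a, b, e⟩ := h1
    exact ⟨a + b, a - b, by linear_combination e⟩
  have h0 := no_sol (w := 𝕚 * (m * (x * y))) hcAB (odd_imul (odd_mul hm (odd_mul hx hy)))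
    (by linear_combination (A ^ 2 - B ^ 2) * e3 - m ^ 2 * (A - B) * e1 - m ^ 2 * x ^ 2 * e2
          - (m * (x * y)) ^ 2 * ii)
  linear_combination -(A + B + x ^ 2) * e1 + (A - B + y ^ 2) * e2 + 4 * h0

theorem finite_nontrivial_solutions_x4_add_y4_eq_i_z2 :
    {p : GaussianInt × GaussianInt × GaussianInt |
      p.1 * p.2.1 * p.2.2 ≠ 0 ∧
      (∀ d : GaussianInt, d ∣ p.1 → d ∣ p.2.1 → d ∣ p.2.2 → IsUnit d) ∧
      p.1 ^ 4 + p.2.1 ^ 4 = sqrtd * p.2.2 ^ 2}.Finite := by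
  have hfin (n : ℕ) (hn : 0 < n) (c : GaussianInt) : {x : GaussianInt | x ^ n = c}.Finite := by
    refine ((Polynomial.nthRoots n c).toFinset.finite_toSet).subset ?_
    intro x hx
    simpa [Polynomial.mem_nthRoots hn] using hx
  refine ((hfin 4 (by norm_num) 1).prod ((hfin 4 (by norm_num) 1).prod
    (hfin 2 (by norm_num) (-2 * 𝕚)))).subset ?_
  rintro ⟨x, y, z⟩ ⟨-, hd, h⟩
  have h' : x ^ 4 + y ^ 4 = 𝕚 * z ^ 2 := h
  obtain ⟨he, hc⟩ := main_units hd h'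
  have hx : x ^ 4 = 1 := by
    apply gi_unit4
    have h1 : IsCoprime x (y ^ 4) := hc.pow_right
    exact h1.isUnit_of_dvd' dvd_rfl (by rw [← he]; exact dvd_pow_self _ (by norm_num))
  have hy : y ^ 4 = 1 := he ▸ hx
  refine ⟨hx, hy, ?_⟩
  change z ^ 2 = -2 * 𝕚
  linear_combination 𝕚 * h' - 𝕚 * hx - 𝕚 * hy + z ^ 2 * ii
end

section
/- The set of triples (x, y, z) of Gaussian integers with xyz ≠ 0, gcd(x, y, z) a unit, and x^4 + 6x^2y^2 + y^4 = z^2 is finite. -/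
open Zsqrtd

namespace MordellAux

/-- the imaginary unit -/
def J : GaussianInt := ⟨0, 1⟩
/-- the prime above two -/
def L : GaussianInt := ⟨1, 1⟩

lemma J_sq : J ^ 2 = -1 := by decide
lemma L_eq : L = 1 + J := by decide
lemma L_sq : L ^ 2 = 2 * J := by decide
lemma L_four : L ^ 4 = -4 := by decide

lemma L_dvd_iff (a : GaussianInt) : L ∣ a ↔ Even (a.re + a.im) := by
  constructor
  · rintro ⟨k, rfl⟩
    simp only [L, Zsqrtd.re_mul, Zsqrtd.im_mul]
    exact ⟨k.re, by ring⟩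
  · rintro ⟨r, hr⟩
    refine ⟨⟨r, r - a.re⟩, ?_⟩
    ext
    · simp [L]
    · simp [L]; omega

lemma J_unit : IsUnit J := IsUnit.of_mul_eq_one (-J) (by decide)

lemma L_prime : Prime L := by
  refine ⟨by decide, ?_, ?_⟩
  · intro h
    have := (L_dvd_iff 1).1 h.dvd
    revert this; decide
  · intro a b h
    rw [L_dvd_iff] at *
    rw [L_dvd_iff]
    rw [← Int.even_mul]
    simp only [Zsqrtd.re_mul, Zsqrtd.im_mul] at h
    obtain ⟨r, hr⟩ := h
    exact ⟨r + a.im * b.im, by linarith⟩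

lemma norm_dvd {k : ℕ} {a : GaussianInt} (h : L ^ k ∣ a) : (2 : ℤ) ^ k ∣ a.norm := by
  obtain ⟨m, rfl⟩ := h
  rw [Zsqrtd.norm_mul]
  have : (L ^ k).norm = 2 ^ k := by
    have := map_pow (Zsqrtd.normMonoidHom (d := -1)) L k
    simpa [Zsqrtd.normMonoidHom, show L.norm = 2 by decide] using this
  rw [this]
  exact dvd_mul_right _ _

lemma unit_cases {u : GaussianInt} (h : IsUnit u) : u = 1 ∨ u = -1 ∨ u = J ∨ u = -J := by
  have h1 : u.norm = 1 := (Zsqrtd.norm_eq_one_iff' (by norm_num) u).2 h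
  rw [Zsqrtd.norm_def] at h1
  obtain ⟨x, y⟩ := u
  simp only at h1
  have hx1 : x ≤ 1 := by nlinarith [mul_self_nonneg y]
  have hx2 : -1 ≤ x := by nlinarith [mul_self_nonneg y]
  have hy1 : y ≤ 1 := by nlinarith
  have hy2 : -1 ≤ y := by nlinarith
  interval_cases x <;> interval_cases y <;> simp_all <;> decide

lemma odd_sq {a : GaussianInt} (h : ¬ L ∣ a) :
    ∃ k, a ^ 2 = 1 + L ^ 5 * k ∨ a ^ 2 = -1 + L ^ 5 * k := by
  have key : ∀ b : GaussianInt, Odd b.re → Even b.im → ∃ k, b ^ 2 = 1 + L ^ 5 * k := by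
    rintro ⟨x, y⟩ ⟨m, hm⟩ ⟨t, ht⟩
    simp only at hm ht
    subst hm; subst ht
    have : L ∣ (⟨m ^ 2 + m - t ^ 2, t + 2 * m * t⟩ : GaussianInt) := by
      rw [L_dvd_iff]
      simp only
      obtain ⟨p, hp⟩ := Int.even_mul_succ_self m
      obtain ⟨q, hq⟩ := Int.even_mul_succ_self t
      exact ⟨p - q + t + m * t, by linarith⟩
    obtain ⟨k, hk⟩ := this
    refine ⟨-k, ?_⟩
    have e : L ^ 5 * -k = 4 * (L * k) := by
      linear_combination (-L * k) * L_four
    rw [e, ← hk]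
    ext
    · simp [pow_two]; ring
    · simp [pow_two]; ring
  rw [L_dvd_iff, Int.not_even_iff_odd] at h
  rcases Int.even_or_odd a.im with hi | hi
  · have : Odd a.re := by
      by_contra h'
      rw [Int.not_odd_iff_even] at h'
      exact (Int.not_even_iff_odd.2 h) (h'.add hi)
    obtain ⟨k, hk⟩ := key a this hi
    exact ⟨k, Or.inl hk⟩
  · have : Even a.re := by
      by_contra h'
      rw [Int.not_even_iff_odd] at h'
      exact (Int.not_even_iff_odd.2 h) (h'.add_odd hi)
    obtain ⟨k, hk⟩ := key (J * a) (by simpa [J] using hi) (by simpa [J] using this)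
    exact ⟨-k, Or.inr (by linear_combination a ^ 2 * J_sq - hk)⟩

lemma odd_four {a : GaussianInt} (h : ¬ L ∣ a) : ∃ k, a ^ 4 = 1 + L ^ 5 * k := by
  obtain ⟨k, hk | hk⟩ := odd_sq h
  · exact ⟨2 * k + L ^ 5 * k ^ 2, by linear_combination (a ^ 2 + 1 + L ^ 5 * k) * hk⟩
  · exact ⟨-2 * k + L ^ 5 * k ^ 2, by linear_combination (a ^ 2 - 1 + L ^ 5 * k) * hk⟩

lemma cop_pow {P Q e b : GaussianInt} {k : ℕ} (hc : IsCoprime P Q) (he : IsUnit e)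
    (h : P * Q = e * b ^ k) : ∃ u d, IsUnit u ∧ P = u * d ^ k := by
  obtain ⟨f, hf⟩ := he.exists_left_inv
  have h1 : P * (f * Q) = b ^ k := by linear_combination f * h + b ^ k * hf
  have hfu : IsUnit f := IsUnit.of_mul_eq_one _ hf
  have h2 : IsCoprime P (f * Q) := (isCoprime_mul_unit_left_right hfu P Q).2 hc
  obtain ⟨d, u, hu⟩ := exists_associated_pow_of_mul_eq_pow' h2 h1
  exact ⟨u, d, u.isUnit, by rw [← hu]; ring⟩

lemma first_step {a b e c : GaussianInt} (he : IsUnit e) (ha : ¬ L ∣ a)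
    (h : a ^ 4 + e * (L * b) ^ 4 = c ^ 2) : L ∣ b := by
  by_contra hb
  have hc : ¬ L ∣ c := by
    intro hc
    apply ha
    apply L_prime.dvd_of_dvd_pow (n := 4)
    have : a ^ 4 = c ^ 2 - L * (e * L ^ 3 * b ^ 4) := by linear_combination h
    rw [this]
    exact dvd_sub (hc.trans (dvd_pow_self _ two_ne_zero)) (dvd_mul_right _ _)
  obtain ⟨k, hk⟩ := odd_four ha
  obtain ⟨l, hl⟩ := odd_four hb
  obtain ⟨m, hm | hm⟩ := odd_sq hc
  · have : L ^ 5 ∣ e * 4 := ⟨k - m + e * L ^ 4 * l, by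
      linear_combination -h + hk + e * L ^ 4 * hl - hm + e * L_four⟩
    have := norm_dvd this
    rcases unit_cases he with rfl | rfl | rfl | rfl <;> revert this <;> decide
  · have : L ^ 5 ∣ e * 4 - 2 := ⟨k - m + e * L ^ 4 * l, by
      linear_combination -h + hk + e * L ^ 4 * hl - hm + e * L_four⟩
    have := norm_dvd this
    rcases unit_cases he with rfl | rfl | rfl | rfl <;> revert this <;> decide

lemma half_step {a b e c : GaussianInt}
    (h : a ^ 4 + e * (L * b) ^ 4 = c ^ 2) :
    ∃ Q, Q * (Q + a ^ 2) = -e * b ^ 4 := by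
  have h2 : (2 : GaussianInt) = -J * L ^ 2 := by decide
  have h1 : (c - a ^ 2) * (c + a ^ 2) = L ^ 4 * (e * b ^ 4) := by linear_combination -h
  have hX : L ∣ c - a ^ 2 := by
    have : L ∣ (c - a ^ 2) * (c + a ^ 2) := by
      rw [h1]; exact ⟨L ^ 3 * (e * b ^ 4), by ring⟩
    rcases L_prime.dvd_or_dvd this with h' | h'
    · exact h'
    · have e1 : c - a ^ 2 = c + a ^ 2 - L * (-J * L * a ^ 2) := by
        linear_combination -a ^ 2 * h2
      rw [e1]
      exact dvd_sub h' (dvd_mul_right _ _)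
  obtain ⟨x, hx⟩ := hX
  have h3 : x * (x - L * (J * a ^ 2)) = L * (L * (e * b ^ 4)) := by
    have : L ^ 2 * (x * (x - L * (J * a ^ 2))) = L ^ 2 * (L * (L * (e * b ^ 4))) := by
      have e2 : c = a ^ 2 + L * x := by linear_combination hx
      subst e2
      linear_combination h1 - L * x * a ^ 2 * h2
    exact mul_left_cancel₀ (pow_ne_zero _ L_prime.ne_zero) this
  have hx' : L ∣ x := by
    have : L ∣ x * (x - L * (J * a ^ 2)) := by rw [h3]; exact dvd_mul_right _ _
    rcases L_prime.dvd_or_dvd this with h' | h'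
    · exact h'
    · have e1 : x = (x - L * (J * a ^ 2)) + L * (J * a ^ 2) := by ring
      rw [e1]
      exact dvd_add h' (dvd_mul_right _ _)
  obtain ⟨y, rfl⟩ := hx'
  refine ⟨J * y, ?_⟩
  have : (4 : GaussianInt) * (J * y * (J * y + a ^ 2)) = 4 * (-e * b ^ 4) := by
    have e2 : c = a ^ 2 + 2 * J * y := by linear_combination hx + y * L_sq
    subst e2
    linear_combination h1 + (e * b ^ 4) * L_four
  exact mul_left_cancel₀ (by decide) this

theorem descent : ∀ n : ℕ, ∀ a b c e : GaussianInt, IsUnit e → IsCoprime a b → L ∣ b → b ≠ 0 →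
    b.norm.natAbs = n → a ^ 4 + e * b ^ 4 = c ^ 2 → False := by
  intro n
  induction n using Nat.strong_induction_on with
  | _ n ih =>
  intro a b c e he hab hLb hb0 hn h
  obtain ⟨b1, rfl⟩ := hLb
  have ha : ¬ L ∣ a := fun h' => L_prime.not_isUnit (hab.isUnit_of_dvd' h' (dvd_mul_right _ _))
  have hb1 := first_step he ha h
  have hb10 : b1 ≠ 0 := right_ne_zero_of_mul hb0
  have hab1 : IsCoprime a b1 := hab.of_mul_right_right
  have hQ : ∃ Q, L ∣ Q ∧ Q * (Q + a ^ 2) = -e * b1 ^ 4 := by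
    obtain ⟨Q, hQ⟩ := half_step h
    have : L ∣ Q * (Q + a ^ 2) := by
      rw [hQ]; exact (hb1.trans (dvd_pow_self _ four_ne_zero)).mul_left _
    rcases L_prime.dvd_or_dvd this with h' | h'
    · exact ⟨Q, h', hQ⟩
    · exact ⟨-(Q + a ^ 2), (dvd_neg).2 h', by linear_combination hQ⟩
  obtain ⟨Q, hLQ, hQ⟩ := hQ
  have hQ0 : Q ≠ 0 := by
    rintro rfl
    rw [zero_mul] at hQ
    exact mul_ne_zero (neg_ne_zero.2 he.ne_zero) (pow_ne_zero 4 hb10) hQ.symm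
  have hcop : IsCoprime Q (Q + a ^ 2) := by
    refine isCoprime_of_prime_dvd (fun h' => hQ0 h'.1) ?_
    intro p hp h1 h2
    have h3 : p ∣ a := hp.dvd_of_dvd_pow ((dvd_add_right h1).1 h2)
    have h4 : p ∣ -e * b1 ^ 4 := hQ ▸ h1.mul_right _
    have h5 : p ∣ b1 := by
      rw [he.neg.dvd_mul_left] at h4
      exact hp.dvd_of_dvd_pow h4
    exact hp.not_isUnit (hab1.isUnit_of_dvd' h3 h5)
  obtain ⟨e2, r, he2, hr⟩ := cop_pow hcop he.neg hQ
  obtain ⟨e1, s, he1, hs⟩ := cop_pow hcop.symm he.neg ((mul_comm _ _).trans hQ)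
  have hLr : L ∣ r := by
    rw [hr, he2.dvd_mul_left] at hLQ
    exact L_prime.dvd_of_dvd_pow hLQ
  have hr0 : r ≠ 0 := by
    rintro rfl
    apply hQ0; rw [hr]; ring
  have hsr : IsCoprime s r := by
    rw [hs, hr] at hcop
    have h1 := hcop.of_mul_left_right.of_mul_right_right
    exact ((IsCoprime.pow_iff (by norm_num) (by norm_num)).1 h1).symm
  have hrb : r ∣ b1 := by
    have h1 : r ^ 4 ∣ b1 ^ 4 := by
      have : r ^ 4 ∣ -e * b1 ^ 4 := by
        rw [← hQ]
        exact (Dvd.intro_left _ hr.symm).mul_right _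
      rwa [he.neg.dvd_mul_left] at this
    exact (IsIntegrallyClosed.pow_dvd_pow_iff four_ne_zero).1 h1
  have hlt : r.norm.natAbs < n := by
    obtain ⟨t, rfl⟩ := hrb
    have ht : t ≠ 0 := right_ne_zero_of_mul hb10
    rw [← hn, Zsqrtd.norm_mul, Zsqrtd.norm_mul, Int.natAbs_mul, Int.natAbs_mul,
      show L.norm.natAbs = 2 by decide]
    have p1 : 0 < r.norm.natAbs := Int.natAbs_pos.2 (GaussianInt.norm_pos.2 hr0).ne'
    have p2 : 0 < t.norm.natAbs := Int.natAbs_pos.2 (GaussianInt.norm_pos.2 ht).ne'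
    nlinarith
  have hLs : ¬ L ∣ s := fun h' => L_prime.not_isUnit (hsr.isUnit_of_dvd' h' hLr)
  have heq : e1 * s ^ 4 - e2 * r ^ 4 = a ^ 2 := by linear_combination hr - hs
  have hno : ¬ (e1 = J ∨ e1 = -J) := by
    intro hJ
    obtain ⟨k, hk⟩ := odd_four hLs
    obtain ⟨m, hm⟩ := odd_sq ha
    obtain ⟨r', rfl⟩ := hLr
    rcases hm with hm | hm
    · have : L ^ 4 ∣ e1 - 1 := ⟨L * m - e1 * L * k + e2 * r' ^ 4, by
        linear_combination heq - e1 * hk + hm⟩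
      have := norm_dvd this
      rcases hJ with rfl | rfl <;> revert this <;> decide
    · have : L ^ 4 ∣ e1 + 1 := ⟨L * m - e1 * L * k + e2 * r' ^ 4, by
        linear_combination heq - e1 * hk + hm⟩
      have := norm_dvd this
      rcases hJ with rfl | rfl <;> revert this <;> decide
  rcases unit_cases he1 with rfl | rfl | h' | h'
  · exact ih _ hlt s r a (-e2) he2.neg hsr hLr hr0 rfl (by linear_combination heq)
  · exact ih _ hlt s r (J * a) e2 he2 hsr hLr hr0 rfl
      (by linear_combination -heq - a ^ 2 * J_sq)
  · exact hno (Or.inl h')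
  · exact hno (Or.inr h')

lemma odd_case {a b c : GaussianInt} (hab : IsCoprime a b) (ha : ¬ L ∣ a)
    (hc : c ≠ 0) (h : a ^ 4 - b ^ 4 = c ^ 2) (hm : L ^ 5 ∣ a ^ 2 - b ^ 2) : False := by
  obtain ⟨m, hm⟩ := hm
  have h2 : (2 : GaussianInt) = -J * L ^ 2 := by decide
  have h2c : (2 : GaussianInt) ∣ c := by
    refine (IsIntegrallyClosed.pow_dvd_pow_iff two_ne_zero).1 ⟨-(L * m) * (a ^ 2 + b ^ 2), ?_⟩
    linear_combination -h + (a ^ 2 + b ^ 2) * hm + (a ^ 2 + b ^ 2) * L * m * L_four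
  obtain ⟨c', rfl⟩ := h2c
  obtain ⟨S, hSdef⟩ : ∃ S, S = L ^ 3 * J * m := ⟨_, rfl⟩
  have hS : a ^ 2 - b ^ 2 = 2 * S := by
    linear_combination hm - 2 * hSdef + L ^ 3 * m * L_sq
  obtain ⟨R, hRdef⟩ : ∃ R, R = a ^ 2 - S := ⟨_, rfl⟩
  have hR : b ^ 2 = R - S := by linear_combination -hS - hRdef
  have hRS : R * S = 1 * c' ^ 2 := by
    have : (4 : GaussianInt) * (R * S) = 4 * (1 * c' ^ 2) := by
      linear_combination h - (a ^ 2 + b ^ 2) * hS - 2 * S * hR + 2 * S * hRdef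
    exact mul_left_cancel₀ (by decide) this
  have hLS : L ∣ S := ⟨L ^ 2 * J * m, by rw [hSdef]; ring⟩
  have hLR : ¬ L ∣ R := by
    intro h'
    apply ha
    apply L_prime.dvd_of_dvd_pow (n := 2)
    rw [show a ^ 2 = R + S by linear_combination -hRdef]
    exact dvd_add h' hLS
  have hR0 : R ≠ 0 := fun h' => hLR (h' ▸ dvd_zero _)
  have hcop : IsCoprime R S := by
    refine isCoprime_of_prime_dvd (fun h' => hR0 h'.1) ?_
    intro p hp h1 h2
    have h3 : p ∣ a := hp.dvd_of_dvd_pow (n := 2) (by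
      rw [show a ^ 2 = R + S by linear_combination -hRdef]; exact dvd_add h1 h2)
    have h4 : p ∣ b := hp.dvd_of_dvd_pow (n := 2) (by rw [hR]; exact dvd_sub h1 h2)
    exact hp.not_isUnit (hab.isUnit_of_dvd' h3 h4)
  obtain ⟨u, r, hu, hr⟩ := cop_pow hcop isUnit_one hRS
  have hLr : ¬ L ∣ r := by
    intro h'
    apply hLR
    rw [hr]
    exact (h'.trans (dvd_pow_self _ two_ne_zero)).mul_left _
  have hR2 : ∃ q, R = q ^ 2 := by
    have hno : ¬ (u = J ∨ u = -J) := by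
      intro hJ
      obtain ⟨k, hk⟩ := odd_sq ha
      obtain ⟨l, hl⟩ := odd_sq hLr
      have : (L ^ 3 ∣ u - 1) ∨ (L ^ 3 ∣ u + 1) := by
        rcases hk with hk | hk <;> rcases hl with hl | hl
        · left
          exact ⟨L ^ 2 * k - J * m - u * L ^ 2 * l, by
            linear_combination hk - u * hl - hSdef + hRdef - hr⟩
        · right
          exact ⟨-(L ^ 2 * k - J * m - u * L ^ 2 * l), by
            linear_combination -(hk - u * hl - hSdef + hRdef - hr)⟩
        · right
          exact ⟨L ^ 2 * k - J * m - u * L ^ 2 * l, by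
            linear_combination hk - u * hl - hSdef + hRdef - hr⟩
        · left
          exact ⟨-(L ^ 2 * k - J * m - u * L ^ 2 * l), by
            linear_combination -(hk - u * hl - hSdef + hRdef - hr)⟩
      rcases this with this | this
      all_goals
        have := norm_dvd this
        rcases hJ with rfl | rfl <;> revert this <;> decide
    rcases unit_cases hu with rfl | rfl | h' | h'
    · exact ⟨r, by rw [hr]; ring⟩
    · exact ⟨J * r, by linear_combination hr - r ^ 2 * J_sq⟩
    · exact (hno (Or.inl h')).elim
    · exact (hno (Or.inr h')).elim
  obtain ⟨q, rfl⟩ := hR2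
  have hq0 : q ≠ 0 := by rintro rfl; exact hR0 (by ring)
  obtain ⟨s, rfl⟩ : q ∣ c' := (IsIntegrallyClosed.pow_dvd_pow_iff two_ne_zero).1 ⟨S, by rw [hRS]; ring⟩
  have hSs : S = s ^ 2 :=
    mul_left_cancel₀ (pow_ne_zero 2 hq0) (by linear_combination hRS)
  have hs0 : s ≠ 0 := by rintro rfl; apply hc; ring
  have hLs : L ∣ s := L_prime.dvd_of_dvd_pow (hSs ▸ hLS)
  rw [hSs] at hcop
  have hqs : IsCoprime q s := (IsCoprime.pow_iff (by norm_num) (by norm_num)).1 hcop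
  refine descent _ q s (a * b) (-1) isUnit_one.neg hqs hLs hs0 rfl ?_
  rw [hSs] at hRdef hR
  linear_combination (-(q ^ 2 - s ^ 2)) * (-hRdef) - (a ^ 2) * hR

lemma quartic_coprime {a b c : GaussianInt} (hab : IsCoprime a b) (ha0 : a ≠ 0) (hb0 : b ≠ 0)
    (hc : c ≠ 0) (h : a ^ 4 - b ^ 4 = c ^ 2) : False := by
  by_cases hb : L ∣ b
  · exact descent _ a b c (-1) isUnit_one.neg hab hb hb0 rfl (by linear_combination h)
  by_cases ha : L ∣ a
  · exact descent _ b a (J * c) (-1) isUnit_one.neg hab.symm ha ha0 rfl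
      (by linear_combination -h - c ^ 2 * J_sq)
  have hab' : IsCoprime a (J * b) := (isCoprime_mul_unit_left_right J_unit a b).2 hab
  have h' : a ^ 4 - (J * b) ^ 4 = c ^ 2 := by
    linear_combination h - b ^ 4 * (J ^ 2 - 1) * J_sq
  obtain ⟨k, hk⟩ := odd_sq ha
  obtain ⟨l, hl⟩ := odd_sq hb
  rcases hk with hk | hk <;> rcases hl with hl | hl
  · exact odd_case hab ha hc h ⟨k - l, by linear_combination hk - hl⟩
  · exact odd_case hab' ha hc h' ⟨k + l, by linear_combination hk + hl - b ^ 2 * J_sq⟩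
  · exact odd_case hab' ha hc h' ⟨k + l, by linear_combination hk + hl - b ^ 2 * J_sq⟩
  · exact odd_case hab ha hc h ⟨k - l, by linear_combination hk - hl⟩

lemma quartic {a b c : GaussianInt} (ha0 : a ≠ 0) (hb0 : b ≠ 0)
    (hc : c ≠ 0) (h : a ^ 4 - b ^ 4 = c ^ 2) : False := by
  obtain ⟨g, a', b', hg, ha, hb, hco⟩ : ∃ g a' b' : GaussianInt, g ≠ 0 ∧ a = g * a' ∧ b = g * b' ∧
      IsCoprime a' b' := by
    have hg : EuclideanDomain.gcd a b ≠ 0 := fun h' => ha0 (EuclideanDomain.gcd_eq_zero_iff.1 h').1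
    obtain ⟨a', ha⟩ := EuclideanDomain.gcd_dvd_left a b
    obtain ⟨b', hb⟩ := EuclideanDomain.gcd_dvd_right a b
    refine ⟨_, a', b', hg, ha, hb, ?_⟩
    refine ⟨EuclideanDomain.gcdA a b, EuclideanDomain.gcdB a b, mul_left_cancel₀ hg ?_⟩
    have := EuclideanDomain.gcd_eq_gcd_ab a b
    linear_combination -this - EuclideanDomain.gcdA a b * ha - EuclideanDomain.gcdB a b * hb
  subst ha; subst hb
  obtain ⟨c', rfl⟩ : g ^ 2 ∣ c := (IsIntegrallyClosed.pow_dvd_pow_iff two_ne_zero).1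
    ⟨a' ^ 4 - b' ^ 4, by linear_combination -h⟩
  refine quartic_coprime hco (right_ne_zero_of_mul ha0) (right_ne_zero_of_mul hb0)
    (right_ne_zero_of_mul hc) (mul_left_cancel₀ (pow_ne_zero 4 hg) ?_)
  linear_combination h

lemma no_sqrt_eight (t : GaussianInt) (h : t ^ 2 = 8) : False := by
  have h1 := congrArg Zsqrtd.re h
  have h2 := congrArg Zsqrtd.im h
  obtain ⟨p, q⟩ := t
  simp [pow_two] at h1 h2
  have h3 : p * q = 0 := by linarith
  rcases mul_eq_zero.1 h3 with rfl | rfl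
  · nlinarith
  · have : p ≤ 2 := by nlinarith
    have : -2 ≤ p := by nlinarith
    interval_cases p <;> simp at h1

lemma no_diag {x z : GaussianInt} (hx : x ≠ 0) (h : 8 * x ^ 4 = z ^ 2) : False := by
  obtain ⟨t, rfl⟩ : x ^ 2 ∣ z := (IsIntegrallyClosed.pow_dvd_pow_iff two_ne_zero).1 ⟨8, by linear_combination -h⟩
  exact no_sqrt_eight t (mul_left_cancel₀ (pow_ne_zero 4 hx) (by linear_combination -h))

lemma sol {x y z : GaussianInt} (hx : x ≠ 0) (hy : y ≠ 0) (hz : z ≠ 0)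
    (h : x ^ 4 + 6 * x ^ 2 * y ^ 2 + y ^ 4 = z ^ 2) : y = J * x ∨ y = -(J * x) := by
  by_cases hu : x + y = 0
  · have : y = -x := by linear_combination hu
    subst this
    exact (no_diag (z := z) hx (by linear_combination h)).elim
  by_cases hv : x - y = 0
  · have : y = x := by linear_combination -hv
    subst this
    exact (no_diag (z := z) hx (by linear_combination h)).elim
  by_cases hw : x ^ 2 + y ^ 2 = 0
  · have : (y - J * x) * (y + J * x) = 0 := by linear_combination hw - x ^ 2 * J_sq
    rcases mul_eq_zero.1 this with h' | h'
    · left; linear_combination h'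
    · right; linear_combination h'
  refine (quartic (a := z) (b := (x + y) * (x - y)) (c := 4 * x * y * (x ^ 2 + y ^ 2)) hz
    (mul_ne_zero hu hv) (mul_ne_zero (mul_ne_zero (mul_ne_zero (by decide) hx) hy) hw) ?_).elim
  linear_combination -(z ^ 2 + x ^ 4 + 6 * x ^ 2 * y ^ 2 + y ^ 4) * h

end MordellAux

open MordellAux in
/-- The set of nontrivial solutions over the Gaussian integers of Mordell's
quartic equation `x⁴ + 6x²y² + y⁴ = z²` is finite. -/
theorem finite_nontrivial_solutions_mordell :
    {p : GaussianInt × GaussianInt × GaussianInt |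
      p.1 * p.2.1 * p.2.2 ≠ 0 ∧
      (∀ d : GaussianInt, d ∣ p.1 → d ∣ p.2.1 → d ∣ p.2.2 → IsUnit d) ∧
      p.1 ^ 4 + 6 * p.1 ^ 2 * p.2.1 ^ 2 + p.2.1 ^ 4 = p.2.2 ^ 2}.Finite := by
  have hU : ({1, -1, J, -J} : Set GaussianInt).Finite := Set.toFinite _
  have hfin := hU.prod ((hU.image (fun x => J * x) |>.union (hU.image (fun x => -(J * x)))).prod
    (hU.image (fun x => 2 * J * x ^ 2) |>.union (hU.image (fun x => -(2 * J * x ^ 2)))))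
  refine hfin.subset ?_
  rintro ⟨x, y, z⟩ ⟨h0, hd, h⟩
  simp only at h0 hd h
  have hz := right_ne_zero_of_mul h0
  have hxy := left_ne_zero_of_mul h0
  have hx := left_ne_zero_of_mul hxy
  have hy := right_ne_zero_of_mul hxy
  have hyx := sol hx hy hz h
  have hy2 : y ^ 2 = -x ^ 2 := by
    rcases hyx with rfl | rfl <;> linear_combination x ^ 2 * J_sq
  have hzx : z = 2 * J * x ^ 2 ∨ z = -(2 * J * x ^ 2) := by
    have : (z - 2 * J * x ^ 2) * (z + 2 * J * x ^ 2) = 0 := by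
      linear_combination -h + (5 * x ^ 2 + y ^ 2) * hy2 - 4 * x ^ 4 * J_sq
    rcases mul_eq_zero.1 this with h' | h'
    · left; linear_combination h'
    · right; linear_combination h'
  have hxu : IsUnit x := by
    refine hd x dvd_rfl ?_ ?_
    · rcases hyx with rfl | rfl
      · exact ⟨J, by ring⟩
      · exact ⟨-J, by ring⟩
    · rcases hzx with rfl | rfl
      · exact ⟨2 * J * x, by ring⟩
      · exact ⟨-(2 * J * x), by ring⟩
  have hxm : x ∈ ({1, -1, J, -J} : Set GaussianInt) := by
    simpa using unit_cases hxu
  refine ⟨hxm, ?_, ?_⟩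
  · rcases hyx with h' | h'
    · exact Or.inl ⟨x, hxm, h'.symm⟩
    · exact Or.inr ⟨x, hxm, h'.symm⟩
  · rcases hzx with h' | h'
    · exact Or.inl ⟨x, hxm, h'.symm⟩
    · exact Or.inr ⟨x, hxm, h'.symm⟩
end

section
/- The set of triples (x, y, z) of Gaussian integers with xyz ≠ 0, gcd(x, y, z) a unit, and x^4 - 6x^2y^2 + y^4 = z^2 is finite. -/
open Zsqrtd

namespace MordellNeg

/-- the imaginary unit -/
def I : GaussianInt := ⟨0, 1⟩

lemma I_sq : I * I = -1 := by decide

lemma I_ne : I ≠ 0 := by decide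

/-- the prime above two -/
def lam : GaussianInt := 1 + I

lemma lam_sq : lam * lam = 2 * I := by decide

lemma lam_ne : lam ≠ 0 := by decide

lemma parity (z : GaussianInt) : ∃ k, z = lam * k ∨ z = 1 + lam * k := by
  obtain ⟨a, b⟩ := z
  rcases Int.even_or_odd' (a + b) with ⟨c, h | h⟩
  · refine ⟨⟨c, b - c⟩, Or.inl ?_⟩
    apply Zsqrtd.ext <;> simp [lam, I] <;> omega
  · refine ⟨⟨c, b - c⟩, Or.inr ?_⟩
    apply Zsqrtd.ext <;> simp [lam, I] <;> omega

lemma lam_not_dvd_one : ¬ lam ∣ 1 := by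
  rintro ⟨⟨a, b⟩, h⟩
  have h1 := congrArg Zsqrtd.re h
  have h2 := congrArg Zsqrtd.im h
  simp [lam, I] at h1 h2
  omega

lemma two_not_dvd_lam (c : GaussianInt) : 1 + I ≠ 2 * c := by
  obtain ⟨a, b⟩ := c
  intro h
  have h1 := congrArg Zsqrtd.re h
  simp [I] at h1
  omega

lemma odd_cop {z : GaussianInt} (h : ¬ lam ∣ z) : IsCoprime z 2 := by
  obtain ⟨k, hk | hk⟩ := parity z
  · exact absurd ⟨k, hk⟩ h
  · have h1 : IsCoprime z lam := ⟨1, -k, by rw [hk]; ring⟩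
    have h2 : (2 : GaussianInt) = lam * (lam * (-I)) := by decide
    rw [h2]
    refine h1.mul_right (h1.mul_right ?_)
    exact ⟨0, I, by linear_combination -I_sq⟩

lemma lam_dvd_sq {z : GaussianInt} (h : lam ∣ z ^ 2) : lam ∣ z := by
  obtain ⟨k, hk | hk⟩ := parity z
  · exact ⟨k, hk⟩
  · exfalso
    apply lam_not_dvd_one
    obtain ⟨c, hc⟩ := h
    exact ⟨c - 2 * k - lam * k ^ 2, by rw [hk] at hc; linear_combination hc⟩

lemma odd_form {z : GaussianInt} (h : ¬ lam ∣ z) : ∃ m, z = 1 + 2 * m ∨ z = I + 2 * m := by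
  obtain ⟨k, hk | hk⟩ := parity z
  · exact absurd ⟨k, hk⟩ h
  obtain ⟨m, hm | hm⟩ := parity k
  · exact ⟨I * m, Or.inl (by rw [hk, hm]; linear_combination m * lam_sq)⟩
  · refine ⟨1 + I * m, Or.inr ?_⟩
    rw [hk, hm]
    have : lam = 1 + I := rfl
    linear_combination m * lam_sq + this

lemma unit_cases (u : GaussianInt) (h : IsUnit u) : u = 1 ∨ u = -1 ∨ u = I ∨ u = -I := by
  obtain ⟨a, b⟩ := u
  have h1 := (Zsqrtd.norm_eq_one_iff' (by norm_num) _).2 h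
  simp [Zsqrtd.norm] at h1
  have ha : a ≤ 1 := by nlinarith [mul_self_nonneg b]
  have ha' : -1 ≤ a := by nlinarith [mul_self_nonneg b]
  have hb : b ≤ 1 := by nlinarith [mul_self_nonneg a]
  have hb' : -1 ≤ b := by nlinarith [mul_self_nonneg a]
  interval_cases a <;> interval_cases b <;> simp at h1 <;> decide

lemma sq_dvd {a b : GaussianInt} (h : a ^ 2 ∣ b ^ 2) : a ∣ b :=
  (IsIntegrallyClosed.pow_dvd_pow_iff (by norm_num)).1 h

/-- factors of a square -/
lemma sq_factor {A B C : GaussianInt} (hc : IsCoprime A B) (h : A * B = C ^ 2) :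
    ∃ a, A = a ^ 2 ∨ A = I * a ^ 2 := by
  obtain ⟨d, u, hu⟩ := exists_associated_pow_of_mul_eq_pow' hc h
  rcases unit_cases u u.isUnit with h | h | h | h <;> rw [h] at hu
  · exact ⟨d, Or.inl (by rw [← hu]; ring)⟩
  · exact ⟨I * d, Or.inl (by rw [← hu]; linear_combination -d ^ 2 * I_sq)⟩
  · exact ⟨d, Or.inr (by rw [← hu]; ring)⟩
  · exact ⟨I * d, Or.inr (by rw [← hu]; linear_combination -I * d ^ 2 * I_sq)⟩

lemma no_I_sq (a c : GaussianInt) : I * a ^ 2 ≠ 1 + 2 * c := by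
  obtain ⟨a, b⟩ := a
  obtain ⟨c, d⟩ := c
  intro h
  have h1 := congrArg Zsqrtd.re h
  simp [I, pow_two] at h1
  have : a * b + b * a = 2 * (a * b) := by ring
  omega

lemma sub_step {p q x y : GaussianInt} (hc : IsCoprime p q) (hq : lam ∣ q) (hp0 : p ≠ 0)
    (hq0 : q ≠ 0) (hy : lam ∣ y) (h1 : 2 * (p * q) = y ^ 2) (h2 : p ^ 2 + q ^ 2 = x ^ 2) :
    ∃ r t w : GaussianInt, IsCoprime r t ∧ lam ∣ t ∧ t ≠ 0 ∧ r ^ 4 - t ^ 4 = w ^ 2 ∧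
      t.norm.natAbs < y.norm.natAbs := by
  obtain ⟨y1, rfl⟩ := hy
  have h3 : p * (-I * q) = y1 ^ 2 := by
    have : (2 * I) * (p * (-I * q)) = (2 * I) * y1 ^ 2 := by
      linear_combination h1 + y1 ^ 2 * lam_sq - 2 * p * q * I_sq
    exact mul_left_cancel₀ (by decide) this
  have hc' : IsCoprime p (-I * q) := by
    refine IsCoprime.mul_right ?_ hc
    exact ⟨0, I, by linear_combination -I_sq⟩
  have hnorm : ∀ r t : GaussianInt, r ≠ 0 → t ≠ 0 → y1 = r * t →
      t.norm.natAbs < (lam * y1).norm.natAbs := by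
    intro r t hr ht h
    have e : (lam * y1).norm = 2 * (r.norm * t.norm) := by
      rw [h, Zsqrtd.norm_mul, Zsqrtd.norm_mul]; rfl
    have hr1 : 0 < r.norm := GaussianInt.norm_pos.2 hr
    have ht1 : 0 < t.norm := GaussianInt.norm_pos.2 ht
    have : t.norm < (lam * y1).norm := by rw [e]; nlinarith
    omega
  obtain ⟨r, hr | hr⟩ := sq_factor hc' h3
  · have hr0 : r ≠ 0 := by rintro rfl; simp at hr; exact hp0 hr
    have : r ∣ y1 := sq_dvd ⟨-I * q, by rw [← h3, hr]⟩
    obtain ⟨t, rfl⟩ := this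
    have hq' : -I * q = t ^ 2 := by
      apply mul_left_cancel₀ (pow_ne_zero 2 hr0)
      rw [hr] at h3; linear_combination h3
    have hq2 : q = I * t ^ 2 := by linear_combination I * hq' + q * I_sq
    have ht0 : t ≠ 0 := by rintro rfl; simp at hq2; exact hq0 hq2
    refine ⟨r, t, x, ?_, ?_, ht0, ?_, hnorm r t hr0 ht0 rfl⟩
    · rw [hq', hr] at hc'
      exact (IsCoprime.pow_iff (by norm_num) (by norm_num)).1 hc'
    · apply lam_dvd_sq; rw [← hq']; exact Dvd.dvd.mul_left hq _
    · rw [← h2, hr, hq2]; linear_combination -t ^ 4 * I_sq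
  · have hr0 : r ≠ 0 := by rintro rfl; simp at hr; exact hp0 hr
    have : r ∣ y1 := sq_dvd ⟨I * (-I * q), by rw [← h3, hr]; ring⟩
    obtain ⟨t, rfl⟩ := this
    have hq2 : q = t ^ 2 := by
      apply mul_left_cancel₀ (pow_ne_zero 2 hr0)
      rw [hr] at h3; linear_combination h3 + r ^ 2 * q * I_sq
    have ht0 : t ≠ 0 := by rintro rfl; simp at hq2; exact hq0 hq2
    refine ⟨r, t, I * x, ?_, ?_, ht0, ?_, hnorm r t hr0 ht0 rfl⟩
    · rw [hq2, hr] at hc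
      exact (IsCoprime.pow_iff (by norm_num) (by norm_num)).1 hc.of_mul_left_right
    · apply lam_dvd_sq; rw [← hq2]; exact hq
    · rw [hr, hq2] at h2; linear_combination I * I * h2 + (-t^4 - r ^ 4 * (I * I - 1)) * I_sq

/-- Square congruent to one modulo `2 * (square)` and so on. -/
lemma sq_form {a m k : GaussianInt} (h : (1 + 2 * m) ^ 2 + 2 * I * k ^ 2 = a ^ 2) :
    ∃ n, a = 1 + 2 * n := by
  have ho : ¬ lam ∣ a := by
    rintro ⟨c, rfl⟩
    apply lam_not_dvd_one
    refine ⟨lam * c ^ 2 - (1 - I) * (2 * m + 2 * m ^ 2 + I * k ^ 2), ?_⟩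
    have h2 : (2 : GaussianInt) = lam * (1 - I) := by decide
    linear_combination h - (2 * m + 2 * m ^ 2 + I * k ^ 2) * h2
  obtain ⟨n, hn | hn⟩ := odd_form ho
  · exact ⟨n, hn⟩
  · exfalso
    have h4 : (2 : GaussianInt) * (I * k ^ 2) = 2 * (1 + 2 * (I * n + n ^ 2 - m - m ^ 2 - 1)) := by
      rw [hn] at h; linear_combination h + I_sq
    exact no_I_sq _ _ (mul_left_cancel₀ (by decide) h4)

lemma descent : ∀ (n : ℕ) (x y w : GaussianInt), y.norm.natAbs = n → y ≠ 0 → IsCoprime x y →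
    lam ∣ y → x ^ 4 - y ^ 4 = w ^ 2 → False := by
  intro n
  induction n using Nat.strong_induction_on with
  | _ n ih =>
  have key : ∀ (m y w : GaussianInt), y.norm.natAbs = n → y ≠ 0 → IsCoprime (1 + 2 * m) y →
      lam ∣ y → (1 + 2 * m) ^ 4 - y ^ 4 = w ^ 2 → False := by
    intro m y w hn hy0 hc hy h
    obtain ⟨k, hk⟩ := id hy
    have hy2 : y ^ 2 = 2 * I * k ^ 2 := by rw [hk]; linear_combination k ^ 2 * lam_sq
    have hcop2 : IsCoprime (1 + 2 * m + 0) (2 : GaussianInt) := ⟨1, -m, by ring⟩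
    have hA2 : IsCoprime ((1 + 2 * m) ^ 2 + y ^ 2) (2 : GaussianInt) :=
      ⟨1, -(2 * m + 2 * m ^ 2 + I * k ^ 2), by rw [hy2]; ring⟩
    have hAB : IsCoprime ((1 + 2 * m) ^ 2 + y ^ 2) ((1 + 2 * m) ^ 2 - y ^ 2) := by
      obtain ⟨a, b, hab⟩ := hc.pow (m := 2) (n := 2)
      obtain ⟨c, d, hcd⟩ := hA2
      refine ⟨c + d * (a + b), d * (a - b), ?_⟩
      linear_combination hcd + 2 * d * hab
    have hprod : ((1 + 2 * m) ^ 2 + y ^ 2) * ((1 + 2 * m) ^ 2 - y ^ 2) = w ^ 2 := by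
      rw [← h]; ring
    obtain ⟨a, ha | ha⟩ := sq_factor hAB hprod
    swap
    · exact no_I_sq a (2 * m + 2 * m ^ 2 + I * k ^ 2) (by rw [← ha, hy2]; ring)
    obtain ⟨b, hb | hb⟩ := sq_factor hAB.symm (by rw [mul_comm]; exact hprod)
    swap
    · exact no_I_sq b (2 * m + 2 * m ^ 2 - I * k ^ 2) (by rw [← hb, hy2]; ring)
    obtain ⟨a1, rfl⟩ := sq_form (a := a) (m := m) (k := k) (by rw [← ha, hy2])
    obtain ⟨b1, rfl⟩ := sq_form (a := b) (m := m) (k := I * k)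
      (by rw [← hb, hy2]; linear_combination 2 * I * k ^ 2 * I_sq)
    have hab : IsCoprime (1 + 2 * a1) (1 + 2 * b1) := by
      rw [ha, hb] at hAB
      exact (IsCoprime.pow_iff (by norm_num) (by norm_num)).1 hAB
    have four : (4 : GaussianInt) ≠ 0 := by decide
    have two : (2 : GaussianInt) ≠ 0 := by decide
    have e1 : 2 * ((1 + a1 + b1) * (a1 - b1)) = y ^ 2 := by
      apply mul_left_cancel₀ two; linear_combination hb - ha
    have e2 : (1 + a1 + b1) ^ 2 + (a1 - b1) ^ 2 = (1 + 2 * m) ^ 2 := by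
      apply mul_left_cancel₀ two; linear_combination -hb - ha
    have hpq : IsCoprime (1 + a1 + b1) (a1 - b1) := by
      obtain ⟨c, d, hcd⟩ := hab
      exact ⟨c + d, c - d, by linear_combination hcd⟩
    have hne : (1 + a1 + b1) * (a1 - b1) ≠ 0 := by
      intro h0; rw [h0] at e1; simp at e1; exact hy0 (by simpa using e1.symm)
    have hp0 := left_ne_zero_of_mul hne
    have hq0 := right_ne_zero_of_mul hne
    have fin : ∃ r t w : GaussianInt, IsCoprime r t ∧ lam ∣ t ∧ t ≠ 0 ∧ r ^ 4 - t ^ 4 = w ^ 2 ∧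
      t.norm.natAbs < y.norm.natAbs := by
      by_cases hq : lam ∣ a1 - b1
      · exact sub_step hpq hq hp0 hq0 hy e1 e2
      · refine sub_step hpq.symm ?_ hq0 hp0 hy (by rw [← e1]; ring)
          (x := 1 + 2 * m) (by rw [← e2]; ring)
        apply lam_dvd_sq
        obtain ⟨c, hc'⟩ := parity (a1 - b1)
        rcases hc' with hc' | hc'
        · exact absurd ⟨c, hc'⟩ hq
        have h2 : (2 : GaussianInt) = lam * (1 - I) := by decide
        have e3 : lam ∣ 1 + a1 + b1 := by
          refine ⟨(1 - I) * (1 + b1) + c, ?_⟩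
          linear_combination hc' + (1 + b1) * h2
        exact Dvd.dvd.pow e3 (by norm_num)
    obtain ⟨r, t, w', h1, h2, h3, h4, h5⟩ := fin
    exact ih _ (hn ▸ h5) r t w' rfl h3 h1 h2 h4
  intro x y w hn hy0 hc hy h
  have hx : ¬ lam ∣ x := by
    intro hx
    exact lam_not_dvd_one (hc.isUnit_of_dvd' hx hy).dvd
  obtain ⟨m, rfl | rfl⟩ := odd_form hx
  · exact key m y w hn hy0 hc hy h
  · have e : -I * (I + 2 * m) = 1 + 2 * (-I * m) := by linear_combination -I_sq
    refine key (-I * m) y w hn hy0 ?_ hy ?_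
    · rw [← e]
      exact IsCoprime.mul_left ⟨I, 0, by linear_combination -I_sq⟩ hc
    · rw [← e, ← h]
      linear_combination (I + 2 * m) ^ 4 * (I * I - 1) * I_sq

lemma opp {x y z : GaussianInt} (hc : IsCoprime x y) (hxy : x * y ≠ 0)
    (hP : ¬ lam ∣ x ^ 2 - y ^ 2) (h : x ^ 4 - 6 * x ^ 2 * y ^ 2 + y ^ 4 = z ^ 2) : False := by
  refine descent _ (x ^ 2 - y ^ 2) (2 * (x * y)) (z * (x ^ 2 + y ^ 2)) rfl
    (mul_ne_zero (by decide) hxy) ?_ ?_ ?_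
  · refine (odd_cop hP).mul_right (IsCoprime.mul_right ?_ ?_)
    · obtain ⟨a, b, hab⟩ := (hc.pow_right (n := 2))
      exact ⟨-b, a + b * x, by linear_combination hab⟩
    · obtain ⟨a, b, hab⟩ := (hc.pow_left (m := 2))
      exact ⟨a, b + a * y, by linear_combination hab⟩
  · exact Dvd.dvd.mul_right ⟨1 - I, by decide⟩ _
  · rw [mul_pow z, ← h]; ring

lemma no_mixed {m n z : GaussianInt} (h : (1 + 2 * m) ^ 4 - 6 * (1 + 2 * m) ^ 2 * (I + 2 * n) ^ 2
    + (I + 2 * n) ^ 4 = z ^ 2) : False := by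
  have h1 : z ^ 2 = 8 * (1 + 2 * (2 * (m + m ^ 2) - 2 * (I * n + n ^ 2) + (m + m ^ 2) ^ 2
      + (I * n + n ^ 2) ^ 2 - 6 * (m + m ^ 2) * (I * n + n ^ 2))) := by
    have e : (I + 2 * n) ^ 2 = -1 + 4 * (I * n + n ^ 2) := by linear_combination I_sq
    have e' : (I + 2 * n) ^ 4 = (-1 + 4 * (I * n + n ^ 2)) ^ 2 := by rw [← e]; ring
    rw [← h, e', e]; ring
  generalize (2 * (m + m ^ 2) - 2 * (I * n + n ^ 2) + (m + m ^ 2) ^ 2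
      + (I * n + n ^ 2) ^ 2 - 6 * (m + m ^ 2) * (I * n + n ^ 2)) = c at h1
  have h8 : (8 : GaussianInt) = (2 * lam) ^ 2 * (-I) := by decide
  obtain ⟨t, rfl⟩ : 2 * lam ∣ z := sq_dvd ⟨-I * (1 + 2 * c), by rw [h1, h8]; ring⟩
  have h2 : t ^ 2 = -I * (1 + 2 * c) := by
    apply mul_left_cancel₀ (pow_ne_zero 2 (show 2 * lam ≠ 0 by decide))
    linear_combination h1 + (1 + 2 * c) * h8
  exact no_I_sq t c (by rw [h2]; linear_combination -(1 + 2 * c) * I_sq)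

lemma same {x m z : GaussianInt} (hx : ¬ lam ∣ x) (hc : IsCoprime x (x + 2 * m))
    (h : x ^ 4 - 6 * x ^ 2 * (x + 2 * m) ^ 2 + (x + 2 * m) ^ 4 = z ^ 2) :
    x + 2 * m = x ∨ x + 2 * m = - x := by
  by_contra hne
  push Not at hne
  have h1 : z ^ 2 = (2 * I) ^ 2 * ((x + m) ^ 4 - 6 * (x + m) ^ 2 * m ^ 2 + m ^ 4) := by
    rw [← h]
    linear_combination -4 * ((x + m) ^ 4 - 6 * (x + m) ^ 2 * m ^ 2 + m ^ 4) * I_sq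
  obtain ⟨t, rfl⟩ : 2 * I ∣ z := sq_dvd ⟨_, h1⟩
  refine opp (x := x + m) (y := m) (z := t) ?_ ?_ ?_ ?_
  · obtain ⟨a, b, hab⟩ := hc
    exact ⟨a + b, b - a, by linear_combination hab⟩
  · refine mul_ne_zero ?_ ?_
    · intro h0; exact hne.2 (by linear_combination 2 * h0)
    · rintro rfl; simp at hne
  · intro hd
    apply hx
    apply lam_dvd_sq
    have : x ^ 2 = ((x + m) ^ 2 - m ^ 2) - lam * ((1 - I) * (x * m)) := by
      have h2 : (2 : GaussianInt) = lam * (1 - I) := by decide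
      linear_combination -(x * m) * h2
    rw [this]
    exact dvd_sub hd (dvd_mul_right _ _)
  · apply mul_left_cancel₀ (pow_ne_zero 2 (show 2 * I ≠ 0 by decide))
    linear_combination -h1

lemma main {x y z : GaussianInt} (hc : IsCoprime x y) (hxy : x * y ≠ 0)
    (h : x ^ 4 - 6 * x ^ 2 * y ^ 2 + y ^ 4 = z ^ 2) : y = x ∨ y = -x := by
  by_cases hP : lam ∣ x ^ 2 - y ^ 2
  swap
  · exact (opp hc hxy hP h).elim
  have hx : ¬ lam ∣ x := by
    intro hx
    have : lam ∣ y ^ 2 := by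
      have := dvd_sub (Dvd.dvd.pow hx (two_ne_zero)) hP
      simpa using this
    exact lam_not_dvd_one (hc.isUnit_of_dvd' hx (lam_dvd_sq this)).dvd
  have hy : ¬ lam ∣ y := by
    intro hy
    have : lam ∣ x ^ 2 := by
      have := dvd_add hP (Dvd.dvd.pow hy (two_ne_zero))
      simpa using this
    exact hx (lam_dvd_sq this)
  obtain ⟨m, hm⟩ := odd_form hx
  obtain ⟨n, hn⟩ := odd_form hy
  have hs : y = x + 2 * (n - m) → y = x ∨ y = -x := by
    intro e
    rw [e] at hc h ⊢
    exact same hx hc h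
  rcases hm with hm | hm <;> rcases hn with hn | hn
  · exact hs (by rw [hm, hn]; ring)
  · exact (no_mixed (m := m) (n := n) (z := z) (by rw [← hm, ← hn, h])).elim
  · exact (no_mixed (m := n) (n := m) (z := z) (by rw [← hm, ← hn, ← h]; ring)).elim
  · exact hs (by rw [hm, hn]; ring)

end MordellNeg

/-- The set of nontrivial solutions over the Gaussian integers of the equation
`x⁴ - 6x²y² + y⁴ = z²` is finite. -/
theorem finite_nontrivial_solutions_mordell_neg :
    {p : GaussianInt × GaussianInt × GaussianInt |
      p.1 * p.2.1 * p.2.2 ≠ 0 ∧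
      (∀ d : GaussianInt, d ∣ p.1 → d ∣ p.2.1 → d ∣ p.2.2 → IsUnit d) ∧
      p.1 ^ 4 - 6 * p.1 ^ 2 * p.2.1 ^ 2 + p.2.1 ^ 4 = p.2.2 ^ 2}.Finite := by
  open MordellNeg in
  have hS : ({1, -1, I, -I} : Set GaussianInt).Finite := by simp
  have hT : ({2 * I, -(2 * I)} : Set GaussianInt).Finite := by simp
  refine (hS.prod (hS.prod hT)).subset ?_
  rintro ⟨x, y, z⟩ ⟨h0, hd, h⟩
  simp only at h0 hd h
  have hxy := left_ne_zero_of_mul h0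
  have hc : IsCoprime x y := by
    apply isCoprime_of_dvd
    · rintro ⟨rfl, rfl⟩; simp at hxy
    · intro d hdu _ hdx hdy
      refine hdu (hd d hdx hdy (sq_dvd ?_))
      obtain ⟨a, rfl⟩ := hdx
      obtain ⟨b, rfl⟩ := hdy
      rw [← h]
      exact ⟨d ^ 2 * (a ^ 4 - 6 * a ^ 2 * b ^ 2 + b ^ 4), by ring⟩
  have hm := main hc hxy h
  have hyx : x ∣ y := by rcases hm with rfl | rfl <;> simp
  have hu : IsUnit x := hc.isUnit_of_dvd' dvd_rfl hyx
  have hx := unit_cases x hu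
  have hy := unit_cases y (by rcases hm with rfl | rfl; exacts [hu, hu.neg])
  have hx4 : x ^ 4 = 1 := by rcases hx with rfl | rfl | rfl | rfl <;> decide
  have hz : (z - 2 * I) * (z + 2 * I) = 0 := by
    have e : y ^ 2 = x ^ 2 := by rcases hm with rfl | rfl <;> ring
    have e' : y ^ 4 = x ^ 4 := by rcases hm with rfl | rfl <;> ring
    rw [e, e'] at h
    linear_combination -h - 4 * hx4 - 4 * I_sq
  refine ⟨by simpa using hx, by simpa using hy, ?_⟩
  rcases mul_eq_zero.1 hz with h1 | h1
  · left; linear_combination h1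
  · right; simp only [Set.mem_singleton_iff]; linear_combination h1
end

section
/- If x, y, z are Gaussian integers with xyz ≠ 0, gcd(x, y) a unit, xy not divisible by 1+i, and x^4 + 6x^2y^2 + y^4 = z^2, then x^2 + y^2 = 0 (equivalently y = ±i·x, and x and y are units). -/
open Zsqrtd


def gI : GaussianInt := sqrtd
lemma gI_sq : gI ^ 2 = -1 := by decide
lemma two_eq : (2:GaussianInt) = -gI * (1+gI)^2 := by linear_combination (2+gI) * gI_sq
lemma l_ne : (1 + gI) ≠ 0 := by decide

lemma l_dvd (z : GaussianInt) : (1+gI) ∣ z ↔ 2 ∣ z.re + z.im := by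
  constructor
  · rintro ⟨k, rfl⟩
    simp [gI]; omega
  · rintro ⟨k, hk⟩
    refine ⟨⟨k, z.im - k⟩, ?_⟩
    ext <;> simp [gI] ; omega

lemma gcases (z : GaussianInt) : (∃ k, z = 1 + 2*k) ∨ (∃ k, z = gI + 2*k) ∨ (∃ k, z = 2*k) ∨ (∃ k, z = 1 + gI + 2*k) := by
  have e : ∀ n : ℤ, n = 2 * (n/2) ∨ n = 1 + 2*(n/2) := by intro n; omega
  rcases e z.re with h1 | h1 <;> rcases e z.im with h2 | h2
  · right; right; left; exact ⟨⟨z.re/2, z.im/2⟩, by ext <;> simp <;> omega⟩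
  · right; left; exact ⟨⟨z.re/2, z.im/2⟩, by ext <;> simp [gI] <;> omega⟩
  · left; exact ⟨⟨z.re/2, z.im/2⟩, by ext <;> simp <;> omega⟩
  · right; right; right; exact ⟨⟨z.re/2, z.im/2⟩, by ext <;> simp [gI] <;> omega⟩

lemma odd_cases {z : GaussianInt} (h : ¬ (1+gI) ∣ z) : (∃ k, z = 1 + 2*k) ∨ (∃ k, z = gI + 2*k) := by
  rcases gcases z with h1 | h1 | ⟨k, h1⟩ | ⟨k, h1⟩
  · exact .inl h1
  · exact .inr h1
  · exact absurd ⟨-gI * (1+gI) * k, by rw [h1]; linear_combination k * two_eq⟩ h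
  · exact absurd ⟨1 -gI * (1+gI) * k, by rw [h1]; linear_combination k * two_eq⟩ h

lemma even_cases {z : GaussianInt} (h : (1+gI) ∣ z) : (∃ k, z = 2*k) ∨ (∃ k, z = 1 + gI + 2*k) := by
  rcases gcases z with ⟨k, h1⟩ | ⟨k, h1⟩ | h1 | h1
  · rw [l_dvd, h1] at h; simp at h
  · rw [l_dvd, h1] at h; simp [gI] at h
  · exact .inl h1
  · exact .inr h1

lemma two_even : (1+gI) ∣ (2:GaussianInt) := ⟨-gI*(1+gI), by linear_combination two_eq⟩

lemma odd_add_odd {x y : GaussianInt} (hx : ¬ (1+gI) ∣ x) (hy : ¬ (1+gI) ∣ y) : (1+gI) ∣ x + y := by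
  rw [l_dvd] at *; simp; omega

lemma l_prime : Prime (1+gI) := by
  refine ⟨l_ne, ?_, ?_⟩
  · intro h
    have := h.dvd (a := 1)
    rw [l_dvd] at this; simp at this
  · intro a b h
    by_contra! hc
    obtain ⟨ha, hb⟩ := hc
    rw [l_dvd] at *
    have : (a*b).re + (a*b).im = (a.re+a.im)*(b.re+b.im) - 2*(a.im*b.im) := by simp; ring
    rw [this] at h
    have h3 : 2 ∣ (a.re+a.im)*(b.re+b.im) := by
      have := dvd_add h (Dvd.intro (a.im*b.im) rfl); simpa using this
    rcases Int.prime_two.dvd_or_dvd h3 with h | h <;> contradiction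

lemma unit_cases {e : GaussianInt} (h : IsUnit e) : e = 1 ∨ e = -1 ∨ e = gI ∨ e = -gI := by
  have h1 : e.norm = 1 := (Zsqrtd.norm_eq_one_iff' (by norm_num) e).2 h
  rw [Zsqrtd.norm_def] at h1
  have a1 : e.re ≤ 1 := by nlinarith [mul_self_nonneg e.im]
  have a2 : -1 ≤ e.re := by nlinarith [mul_self_nonneg e.im]
  have a3 : e.im ≤ 1 := by nlinarith [mul_self_nonneg e.re]
  have a4 : -1 ≤ e.im := by nlinarith [mul_self_nonneg e.re]
  obtain ⟨x, y⟩ := e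
  simp only at *
  interval_cases x <;> interval_cases y <;> revert h1 <;> decide

lemma not_two_dvd_aux {z : GaussianInt} (n : ℤ) (h : ¬ (n ∣ z.re ∧ n ∣ z.im)) : ¬ ((n : GaussianInt) ∣ z) := by
  rwa [Zsqrtd.intCast_dvd]

lemma n1 : ¬ (2:GaussianInt) ∣ 1 - gI := not_two_dvd_aux 2 (by simp [gI])
lemma n1' : ¬ (2:GaussianInt) ∣ gI - 1 := not_two_dvd_aux 2 (by simp [gI])
lemma n2 : ¬ (4:GaussianInt) ∣ 2 := not_two_dvd_aux 4 (by simp)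

lemma odd_sq {x : GaussianInt} (hx : ¬ (1+gI) ∣ x) : 2 ∣ x^2 - 1 := by
  rcases odd_cases hx with ⟨k, rfl⟩ | ⟨k, rfl⟩
  · exact ⟨2*(k+k^2), by ring⟩
  · exact ⟨2*(gI*k+k^2) - 1, by linear_combination gI_sq⟩

lemma odd_sq4 {x : GaussianInt} (hx : ¬ (1+gI) ∣ x) : 4 ∣ x^2 - 1 ∨ 4 ∣ x^2 + 1 := by
  rcases odd_cases hx with ⟨k, rfl⟩ | ⟨k, rfl⟩
  · exact .inl ⟨(k+k^2), by ring⟩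
  · exact .inr ⟨(gI*k+k^2), by linear_combination gI_sq⟩

lemma sub_of_sq {x y : GaussianInt} (hx : ¬ (1+gI) ∣ x) (hy : ¬ (1+gI) ∣ y) (h : 4 ∣ x^2 - y^2) : 2 ∣ x - y := by
  obtain ⟨t, ht⟩ := h
  rcases odd_cases hx with ⟨k, rfl⟩ | ⟨k, rfl⟩ <;> rcases odd_cases hy with ⟨m, rfl⟩ | ⟨m, rfl⟩
  · exact ⟨k - m, by ring⟩
  · exact absurd ⟨t - k - k^2 + gI*m+m^2, by linear_combination ht + gI_sq⟩ n2
  · exact absurd ⟨-t - m - m^2 + gI*k+k^2, by linear_combination -ht + gI_sq⟩ n2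
  · exact ⟨k - m, by ring⟩

lemma odd_coprime_two {x : GaussianInt} (hx : ¬ (1+gI) ∣ x) : IsCoprime x 2 := by
  rcases odd_cases hx with ⟨k, rfl⟩ | ⟨k, rfl⟩
  · exact ⟨1, -k, by ring⟩
  · exact ⟨-gI, gI*k, by linear_combination -gI_sq⟩

lemma sq_of_odd {P d e : GaussianInt} (h : 2 ∣ P - 1) (he : IsUnit e) (hP : P = e * d^2) : ∃ c, P = c^2 := by
  have hd : ¬ (1+gI) ∣ d := by
    intro hd
    have h1 : (1+gI) ∣ P := hP ▸ (dvd_mul_of_dvd_right (dvd_pow hd two_ne_zero) e)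
    have h2 := dvd_sub h1 (two_even.trans h)
    rw [sub_sub_cancel] at h2
    exact l_prime.not_isUnit (isUnit_of_dvd_one h2)
  obtain ⟨t, ht⟩ := odd_sq hd
  obtain ⟨v, hv⟩ := h
  rcases unit_cases he with rfl | rfl | rfl | rfl
  · exact ⟨d, by linear_combination hP⟩
  · exact ⟨gI * d, by linear_combination hP - d^2*gI_sq⟩
  · exact absurd ⟨v - gI * t, by linear_combination hv - gI * ht - hP⟩ n1'
  · refine absurd ⟨v + gI * t + 1, by linear_combination hv + gI * ht - hP⟩ n1

lemma sq_of_coprime {P Q k : GaussianInt} (hc : IsCoprime P Q) (h : P * Q = k^2) (h2 : 2 ∣ P - 1) : ∃ c, P = c^2 := by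
  obtain ⟨d, u, hd⟩ := exists_associated_pow_of_mul_eq_pow' hc h
  exact sq_of_odd h2 u.isUnit (d := d) (by rw [← hd]; ring)

lemma cop_congr {x y x' y' : GaussianInt} (h : IsCoprime x y) (hx : x = x') (hy : y = y') : IsCoprime x' y' := by
  rwa [← hx, ← hy]

lemma pow_dvd_aux {n : ℕ} (hn : n ≠ 0) {a b : GaussianInt} (h : a^n ∣ b^n) : a ∣ b :=
  (IsIntegrallyClosed.pow_dvd_pow_iff hn).1 h

lemma unit_sq {e : GaussianInt} (h : IsUnit e) : e^2 = 1 ∨ e^2 = -1 := by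
  rcases unit_cases h with rfl | rfl | rfl | rfl
  · left; ring
  · left; ring
  · right; exact gI_sq
  · right; linear_combination gI_sq

lemma unit_sq' {e f g : GaussianInt} (he : IsUnit e) (h : e * f = g^2) (hg : IsUnit g) :
    (e^2 = 1 ∧ f^2 = 1) ∨ (e^2 = -1 ∧ f^2 = -1) := by
  have h1 : e^2*f^2 = 1 := by
    have : e^2*f^2 = (g^2)^2 := by rw [← h]; ring
    rw [this]; rcases unit_sq hg with h | h <;> rw [h] <;> ring
  rcases unit_sq he with h | h <;> rw [h] at h1
  · left; exact ⟨h, by linear_combination h1⟩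
  · right; exact ⟨h, by linear_combination -h1⟩

/-- Second half of the descent. -/
lemma descent2 {s R p w : GaussianInt} (hs : ¬ (1+gI) ∣ s) (hR : (1+gI) ∣ R) (hR0 : R ≠ 0)
    (hc : IsCoprime s R) (h1 : s^2 - R^2 = p^2) (h2 : s^2 - 2*R^2 = w^2) :
    ∃ c d w : GaussianInt, c^4+6*c^2*d^2+d^4 = w^2 ∧ IsCoprime c d ∧ (1+gI) ∣ d ∧ 2*d ∣ R := by
  have hp : ¬ (1+gI) ∣ p := by
    intro hp
    apply hs
    have : (1+gI) ∣ s^2 := by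
      have := dvd_add (dvd_pow hp two_ne_zero) (dvd_pow hR two_ne_zero)
      rw [← h1] at this; simpa using this
    exact l_prime.dvd_of_dvd_pow this
  have hR2 : ∃ k, R = 2*k := by
    rcases even_cases hR with h | ⟨k, hk⟩
    · exact h
    · exfalso
      have hR4 : R^2 = 2*gI + 4*((1+gI)*k+k^2) := by rw [hk]; linear_combination gI_sq
      have m0 : ¬ (4:GaussianInt) ∣ 2*gI := not_two_dvd_aux 4 (by simp [gI])
      have m1 : ¬ (4:GaussianInt) ∣ 2*gI-2 := not_two_dvd_aux 4 (by simp [gI])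
      have m2 : ¬ (4:GaussianInt) ∣ 2*gI+2 := not_two_dvd_aux 4 (by simp [gI])
      rcases odd_sq4 hs with ⟨t, ht⟩ | ⟨t, ht⟩ <;> rcases odd_sq4 hp with ⟨v, hv⟩ | ⟨v, hv⟩
      · exact m0 ⟨t - v - ((1+gI)*k+k^2), by linear_combination ht - hv - h1 - hR4⟩
      · exact m1 ⟨t - v - ((1+gI)*k+k^2), by linear_combination ht - hv - h1 - hR4⟩
      · exact m2 ⟨t - v - ((1+gI)*k+k^2), by linear_combination ht - hv - h1 - hR4⟩
      · exact m0 ⟨t - v - ((1+gI)*k+k^2), by linear_combination ht - hv - h1 - hR4⟩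
  obtain ⟨k, rfl⟩ := hR2
  obtain ⟨m, hm⟩ := sub_of_sq hs hp ⟨k^2, by linear_combination h1⟩
  have hk0 : k ≠ 0 := right_ne_zero_of_mul hR0
  obtain ⟨n, rfl⟩ : ∃ n, s = m + n := ⟨s - m, by ring⟩
  have hpe : p = n - m := by linear_combination -hm
  subst hpe
  have two0 : (2:GaussianInt) ≠ 0 := by decide
  have hmn : m * n = k^2 := by
    apply mul_left_cancel₀ two0; apply mul_left_cancel₀ two0
    linear_combination h1
  have hco : IsCoprime m n := by
    have h3 : IsCoprime (m+n) (m*n) := by rw [hmn]; exact (hc.of_mul_right_right).pow_right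
    have h4 := h3.of_mul_right_left
    have := h4.symm.add_mul_left_right (-1)
    simpa using this
  obtain ⟨c, u, hu⟩ := exists_associated_pow_of_mul_eq_pow' hco hmn
  obtain ⟨d, v, hv⟩ := exists_associated_pow_of_mul_eq_pow' hco.symm (by rw [mul_comm]; exact hmn)
  have hcd2 : (c*d)^2 ∣ k^2 := ⟨u*v, by rw [← hmn, ← hu, ← hv]; ring⟩
  obtain ⟨e, he⟩ := pow_dvd_aux two_ne_zero hcd2
  have huv : (u:GaussianInt)*v = e^2 := by
    have : (c*d)^2 ≠ 0 := by
      intro h0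
      rw [h0, zero_dvd_iff] at hcd2
      exact hk0 (by simpa using hcd2)
    apply mul_left_cancel₀ this
    have : m * n = (c*d*e)^2 := by rw [hmn, he]
    linear_combination this + n * hu + c^2*u*hv
  have heu : IsUnit e := by
    rw [← isUnit_pow_iff two_ne_zero, ← huv]; exact u.isUnit.mul v.isUnit
  have hccd : IsCoprime c d := by
    rw [← hu, ← hv] at hco
    exact (IsCoprime.pow_iff two_pos two_pos).1 hco.of_mul_left_left.of_mul_right_left
  -- the new equation, with either sign
  have key : ∃ c d w : GaussianInt, c^4+6*c^2*d^2+d^4 = w^2 ∧ IsCoprime c d ∧ c * d ∣ k ∧ (1+gI) ∣ c * d := by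
    have hev : (1+gI) ∣ c * d := by
      by_contra hcon
      have hco : ¬ (1+gI) ∣ c := fun h => hcon (h.mul_right _)
      have hdo : ¬ (1+gI) ∣ d := fun h => hcon (h.mul_left _)
      apply hs
      have a1 : ¬ (1+gI) ∣ m := by
        rw [← hu]; intro h; exact hco (l_prime.dvd_of_dvd_pow ((Units.dvd_mul_right).1 h))
      have a2 : ¬ (1+gI) ∣ n := by
        rw [← hv]; intro h; exact hdo (l_prime.dvd_of_dvd_pow ((Units.dvd_mul_right).1 h))
      exact odd_add_odd a1 a2
    have hIu : IsUnit gI := IsUnit.of_mul_eq_one (-gI) (by linear_combination -gI_sq)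
    have E : (u:GaussianInt)^2*c^4 + (v:GaussianInt)^2*d^4 - 6*((u:GaussianInt)*v)*c^2*d^2 = w^2 := by
      rw [← h2]
      have E1 : (m+n)^2 - 2*(2*k)^2 = m^2 + n^2 - 6*(m*n) := by linear_combination 8*hmn
      rw [E1, ← hu, ← hv]; ring
    have dI : c * (gI * d) ∣ k := by
      refine ⟨-gI*e, ?_⟩; linear_combination he + c*d*e*gI_sq
    have eI : (1+gI) ∣ c * (gI * d) := by
      rw [mul_left_comm]; exact hev.mul_left _
    have cI : IsCoprime c (gI * d) := (isCoprime_mul_unit_left_right hIu c d).2 hccd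
    rcases unit_sq' u.isUnit huv heu with ⟨a, b⟩ | ⟨a, b⟩ <;>
    rcases unit_sq heu with h | h <;> rw [huv, a, b, h] at E
    · exact ⟨c, gI*d, w, by linear_combination E + (6*c^2*d^2 + d^4*(gI^2-1))*gI_sq, cI, dI, eI⟩
    · exact ⟨c, d, w, by linear_combination E, hccd, ⟨e, he⟩, hev⟩
    · exact ⟨c, d, gI*w, by linear_combination -E - w^2*gI_sq, hccd, ⟨e, he⟩, hev⟩
    · exact ⟨c, gI*d, gI*w, by linear_combination -E - w^2*gI_sq + (6*c^2*d^2 + d^4*(gI^2-1))*gI_sq, cI, dI, eI⟩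
  obtain ⟨c, d, w, k1, k2, k3, k4⟩ := key
  rcases l_prime.dvd_or_dvd k4 with h | h
  · exact ⟨d, c, w, by linear_combination k1, k2.symm, h, mul_dvd_mul_left 2 ((dvd_mul_right _ _).trans k3)⟩
  · exact ⟨c, d, w, by linear_combination k1, k2, h, mul_dvd_mul_left 2 ((dvd_mul_left _ _).trans k3)⟩

/-- First half of the descent. -/
lemma descent1 {a b m n : GaussianInt} (hc : IsCoprime a b) (hb : (1+gI) ∣ b) (hb0 : b ≠ 0)
    (h1 : m * n = b^4) (h2 : 2*m + n = a^2+3*b^2) :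
    ∃ c d w : GaussianInt, c^4+6*c^2*d^2+d^4 = w^2 ∧ IsCoprime c d ∧ (1+gI) ∣ d ∧ 2*d ∣ b := by
  have ha : ¬ (1+gI) ∣ a := fun h => l_prime.not_isUnit (hc.isUnit_of_dvd' h hb)
  have hco : IsCoprime m n := by
    have h3 : IsCoprime (a^2+3*b^2) b := by
      have := (hc.pow_left (m := 2)).add_mul_left_left (3*b)
      exact cop_congr this (by ring) (by ring)
    have h4 : IsCoprime (2*m+n) (m*n) := by rw [h1, h2]; exact h3.pow_right
    have h5 := h4.of_mul_right_left
    have := h5.symm.add_mul_left_right (-2)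
    exact cop_congr this (by ring) (by ring)
  obtain ⟨r, u, hu⟩ := exists_associated_pow_of_mul_eq_pow' hco h1
  obtain ⟨s, v, hv⟩ := exists_associated_pow_of_mul_eq_pow' hco.symm (by rw [mul_comm]; exact h1)
  have hrs4 : (r*s)^4 ∣ b^4 := ⟨u*v, by rw [← h1, ← hu, ← hv]; ring⟩
  obtain ⟨e, he⟩ := pow_dvd_aux four_ne_zero hrs4
  have huv : (u:GaussianInt)*v = e^4 := by
    have : (r*s)^4 ≠ 0 := by
      intro h0
      rw [h0, zero_dvd_iff] at hrs4
      exact hb0 (by simpa using hrs4)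
    apply mul_left_cancel₀ this
    have : m * n = (r*s*e)^4 := by rw [h1, he]
    linear_combination this + n * hu + r^4*u*hv
  have heu : IsUnit e := by
    rw [← isUnit_pow_iff four_ne_zero, ← huv]; exact u.isUnit.mul v.isUnit
  have huv1 : (u:GaussianInt)*v = 1 := by
    rw [huv]
    have : e^4 = (e^2)^2 := by ring
    rw [this]; rcases unit_sq heu with h | h <;> rw [h] <;> ring
  have hrs : IsCoprime s r := by
    rw [← hu, ← hv] at hco
    exact ((IsCoprime.pow_iff four_pos four_pos).1 hco.of_mul_left_left.of_mul_right_left).symm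
  have two_b2 : ∀ {b : GaussianInt}, (1+gI) ∣ b → (2:GaussianInt) ∣ b^2 := by
    rintro b ⟨t, rfl⟩
    exact ⟨gI*t^2, by linear_combination t^2*gI_sq⟩
  have hn : 2 ∣ n - 1 := by
    obtain ⟨t, ht⟩ := odd_sq ha
    obtain ⟨q, hq⟩ := two_b2 hb
    exact ⟨t + 3*q - m, by linear_combination h2 + ht + 3*hq⟩
  have hno : ¬ (1+gI) ∣ n := by
    intro h
    have h2 := dvd_sub h (two_even.trans hn)
    rw [sub_sub_cancel] at h2
    exact l_prime.not_isUnit (isUnit_of_dvd_one h2)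
  have hs : ¬ (1+gI) ∣ s := by
    intro h
    exact hno (hv ▸ (dvd_pow h four_ne_zero).mul_right _)
  have hr : (1+gI) ∣ r := by
    have : (1+gI) ∣ r*s*e := he ▸ hb
    rcases l_prime.dvd_or_dvd this with h | h
    · exact (l_prime.dvd_or_dvd h).resolve_right hs
    · exact absurd (isUnit_of_dvd_unit h heu) l_prime.not_isUnit
  have hr0 : r ≠ 0 := by
    rintro rfl
    exact hb0 (by rw [he]; ring)
  -- v = ±1
  have hv1 : (u:GaussianInt) = v ∧ ((v:GaussianInt) = 1 ∨ (v:GaussianInt) = -1) := by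
    obtain ⟨t, ht⟩ := odd_sq hs
    obtain ⟨q, hq⟩ := hn
    have hvv : (2:GaussianInt) ∣ v - 1 := ⟨q - v*(t*(s^2+1)), by linear_combination hq + hv - v*(s^2+1)*ht⟩
    rcases unit_cases v.isUnit with h | h | h | h <;> rw [h] at huv1 hvv ⊢
    · exact ⟨by linear_combination huv1, .inl rfl⟩
    · exact ⟨by linear_combination -huv1, .inr rfl⟩
    · exact absurd hvv n1'
    · obtain ⟨j, hj⟩ := hvv
      exact absurd ⟨j+1, by linear_combination hj⟩ n1
  obtain ⟨huv', hv1⟩ := hv1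
  have hb2 : b^2 = e^2 * (r*s)^2 := by rw [he]; ring
  have E : a^2 = v * (2*r^4 + s^4) - 3*e^2*(r*s)^2 := by
    linear_combination -h2 - 2*hu - hv - 3*hb2 + 2*r^4*huv'
  have hIu : IsUnit gI := IsUnit.of_mul_eq_one (-gI) (by linear_combination -gI_sq)
  have key : ∃ R a' : GaussianInt, (s^2-R^2)*(s^2-2*R^2) = a'^2 ∧ R ≠ 0 ∧ (1+gI) ∣ R ∧ IsCoprime s R ∧ R ∣ b := by
    have d0 : r ∣ b := ⟨s*e, by rw [he]; ring⟩
    have dI : gI * r ∣ b := (hIu.mul_left_dvd).2 d0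
    have cI : IsCoprime s (gI * r) := (isCoprime_mul_unit_left_right hIu s r).2 hrs
    have zI : gI * r ≠ 0 := mul_ne_zero hIu.ne_zero hr0
    rcases unit_sq heu with h | h <;> rcases hv1 with h' | h' <;> rw [h, h'] at E
    · exact ⟨r, a, by linear_combination -E, hr0, hr, hrs, d0⟩
    · exact ⟨gI*r, gI*a, by linear_combination E - a^2*gI_sq + (2*r^4*(gI^2-1) - 3*r^2*s^2)*gI_sq, zI, hr.mul_left _, cI, dI⟩
    · exact ⟨gI*r, a, by linear_combination -E + (2*r^4*(gI^2-1) - 3*r^2*s^2)*gI_sq, zI, hr.mul_left _, cI, dI⟩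
    · exact ⟨r, gI*a, by linear_combination E - a^2*gI_sq, hr0, hr, hrs, d0⟩
  obtain ⟨R, a', k1, k2, k3, k4, k5⟩ := key
  have co2 : IsCoprime (s^2-R^2) (s^2-2*R^2) := by
    have h0 : IsCoprime (s^2) (R^2) := k4.pow
    have h3 : IsCoprime (s^2-R^2) (R^2) := by
      have := h0.add_mul_left_left (-1)
      exact cop_congr this (by ring) (by ring)
    have := h3.add_mul_left_right (1)
    have := h3.neg_right.add_mul_left_right (1)
    exact cop_congr this (by ring) (by ring)
  obtain ⟨t, ht⟩ := odd_sq hs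
  obtain ⟨q, hq⟩ := two_b2 k3
  obtain ⟨p, hp⟩ := sq_of_coprime co2 k1 ⟨t - q, by linear_combination ht - hq⟩
  obtain ⟨w, hw⟩ := sq_of_coprime co2.symm (by rw [mul_comm]; exact k1) ⟨t - 2*q, by linear_combination ht - 2*hq⟩
  obtain ⟨c, d, w, g1, g2, g3, g4⟩ := descent2 hs k3 k2 k4 hp hw
  exact ⟨c, d, w, g1, g2, g3, g4.trans k5⟩

lemma even_case_aux (N : ℕ) : ∀ a b q : GaussianInt, b.norm.natAbs ≤ N → IsCoprime a b → (1+gI) ∣ b →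
    a^4+6*a^2*b^2+b^4 = q^2 → b = 0 := by
  induction N with
  | zero =>
    intro a b q hN _ _ _
    have : b.norm = 0 := by omega
    exact (GaussianInt.norm_eq_zero).1 this
  | succ N ih =>
    intro a b q hN hc hb heq
    by_contra hb0
    have ha : ¬ (1+gI) ∣ a := fun h => l_prime.not_isUnit (hc.isUnit_of_dvd' h hb)
    have main : ∃ c d w : GaussianInt, c^4+6*c^2*d^2+d^4 = w^2 ∧ IsCoprime c d ∧ (1+gI) ∣ d ∧ 2*d ∣ b := by
      have hA : ¬ (1+gI) ∣ a^2+3*b^2 := by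
        intro h
        have h3 := (dvd_add_left ((dvd_pow hb two_ne_zero).mul_left 3)).1 h
        exact ha (l_prime.dvd_of_dvd_pow h3)
      have hq : ¬ (1+gI) ∣ q := by
        intro h
        have h3 : (1+gI) ∣ a^4 + b * (6*a^2*b+b^3) := by
          have := dvd_pow h two_ne_zero
          rw [← heq] at this
          convert this using 1; ring
        have h4 := (dvd_add_left (hb.mul_right _)).1 h3
        exact ha (l_prime.dvd_of_dvd_pow h4)
      have hAq : (a^2+3*b^2)^2 - q^2 = 8*b^4 := by rw [← heq]; ring
      obtain ⟨m, hm⟩ := sub_of_sq hA hq ⟨2*b^4, by rw [hAq]; ring⟩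
      have two0 : (2:GaussianInt) ≠ 0 := by decide
      obtain ⟨n, hn⟩ : ∃ n, n = a^2+3*b^2 - m := ⟨_, rfl⟩
      have hmn : m * n = 2*b^4 := by
        apply mul_left_cancel₀ two0; apply mul_left_cancel₀ two0
        have : q = a^2+3*b^2 - 2*m := by linear_combination -hm
        rw [this] at hAq
        linear_combination hAq + 4*m*hn
      have hsum : m + n = a^2+3*b^2 := by rw [hn]; ring
      have fin : ∀ m n : GaussianInt, m * n = 2*b^4 → m + n = a^2+3*b^2 → (1+gI) ∣ m → 
          ∃ c d w : GaussianInt, c^4+6*c^2*d^2+d^4 = w^2 ∧ IsCoprime c d ∧ (1+gI) ∣ d ∧ 2*d ∣ b := by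
        intro m n hmn hsum hm
        have hno : ¬ (1+gI) ∣ n := by
          intro h; apply hA; rw [← hsum]; exact dvd_add hm h
        have : (2:GaussianInt) ∣ m := (odd_coprime_two hno).symm.dvd_of_dvd_mul_right ⟨_, hmn⟩
        obtain ⟨m', rfl⟩ := this
        exact descent1 hc hb hb0 (mul_left_cancel₀ two0 (by linear_combination hmn)) hsum
      rcases l_prime.dvd_or_dvd (show (1+gI) ∣ m*n by rw [hmn]; exact two_even.mul_right _) with h | h
      · exact fin m n hmn hsum h
      · exact fin n m (by rw [mul_comm]; exact hmn) (by rw [add_comm]; exact hsum) h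
    obtain ⟨c, d, w, g1, g2, g3, t, ht⟩ := main
    have hd0 : d ≠ 0 := by
      rintro rfl; exact hb0 (by rw [ht]; ring)
    apply hd0
    refine ih c d w ?_ g2 g3 g1
    have hnb : b.norm.natAbs = 4 * d.norm.natAbs * t.norm.natAbs := by
      rw [ht, Zsqrtd.norm_mul, Zsqrtd.norm_mul, Int.natAbs_mul, Int.natAbs_mul]; congr 2
    have t0 : t.norm.natAbs ≠ 0 := by
      intro h0
      have : t.norm = 0 := by omega
      rw [GaussianInt.norm_eq_zero] at this
      exact hb0 (by rw [ht, this]; ring)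
    have d0 : d.norm.natAbs ≠ 0 := by
      intro h0
      have : d.norm = 0 := by omega
      rw [GaussianInt.norm_eq_zero] at this
      exact hd0 this
    have : 4 * d.norm.natAbs ≤ b.norm.natAbs := by
      rw [hnb]; exact Nat.le_mul_of_pos_right _ (Nat.pos_of_ne_zero t0)
    omega

lemma even_case {a b q : GaussianInt} (hc : IsCoprime a b) (hb : (1+gI) ∣ b)
    (h : a^4+6*a^2*b^2+b^4 = q^2) : b = 0 := even_case_aux _ a b q le_rfl hc hb h

/-- Case `x² ≡ Y² mod 4` of the twisted equation. -/
lemma odd_twist {x Y z u : GaussianInt} (hc : IsCoprime x Y) (hx : ¬ (1+gI) ∣ x) (hY : ¬ (1+gI) ∣ Y)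
    (h : x^4 - 6*x^2*Y^2 + Y^4 = z^2) (hu : x^2 - Y^2 = 4*u) : u = 0 := by
  have two0 : (2:GaussianInt) ≠ 0 := by decide
  have h4 : (2:GaussianInt)^2 ∣ z^2 := ⟨4*u^2 - x^2*Y^2, by linear_combination -h + (x^2-Y^2+4*u)*hu⟩
  obtain ⟨w, rfl⟩ := pow_dvd_aux two_ne_zero h4
  have hw : 4*u^2 - x^2*Y^2 = w^2 := by
    apply mul_left_cancel₀ two0; apply mul_left_cancel₀ two0
    linear_combination h - (x^2-Y^2+4*u)*hu
  have hxY : ¬ (1+gI) ∣ x * Y := fun h => (l_prime.dvd_or_dvd h).elim hx hY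
  obtain ⟨j, hj⟩ := sub_of_sq hx hY ⟨u, hu⟩
  obtain ⟨i, hi⟩ := odd_sq hx
  have hxY2 : x * Y = 1 + 2*(i - x*j) := by linear_combination hi - x*hj
  have hPo : ¬ (1+gI) ∣ x*Y - 2*u := by
    intro h; apply hxY
    have := dvd_add h (two_even.mul_right u); simpa using this
  have co1 : IsCoprime (x*Y) (2*u) := by
    have a1 : IsCoprime x (x^2-Y^2) := by
      have := (hc.pow_right (n := 2)).neg_right.add_mul_left_right x
      exact cop_congr this (by ring) (by ring)
    have a2 : IsCoprime Y (x^2-Y^2) := by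
      have := (hc.symm.pow_right (n := 2)).add_mul_left_right (-Y)
      exact cop_congr this (by ring) (by ring)
    have a3 := a1.mul_left a2
    rw [hu, show (4:GaussianInt)*u = 2*(2*u) by ring] at a3
    exact a3.of_mul_right_right
  have co : IsCoprime (x*Y - 2*u) (x*Y + 2*u) := by
    have a1 : IsCoprime (x*Y - 2*u) (2*u) := by
      have := co1.add_mul_left_left (-1)
      exact cop_congr this (by ring) (by ring)
    have a2 := (odd_coprime_two hPo).mul_right a1
    have := a2.add_mul_left_right 1
    exact cop_congr this (by ring) (by ring)
  have hprod : (x*Y - 2*u)*(x*Y + 2*u) = (gI*w)^2 := by linear_combination -hw - w^2*gI_sq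
  obtain ⟨s, hs⟩ := sq_of_coprime co hprod ⟨i - x*j - u, by linear_combination hxY2⟩
  obtain ⟨t, ht⟩ := sq_of_coprime co.symm (by rw [mul_comm]; exact hprod)
    ⟨i - x*j + u, by linear_combination hxY2⟩
  have hso : ¬ (1+gI) ∣ s := by
    intro h; apply hPo; rw [hs]; exact dvd_pow h two_ne_zero
  have hto : ¬ (1+gI) ∣ t := by
    intro h; apply hxY
    have := dvd_sub (dvd_pow h two_ne_zero) (two_even.mul_right u)
    rw [← ht] at this; simpa using this
  obtain ⟨b, hb⟩ := sub_of_sq hso hto ⟨-u, by linear_combination ht - hs⟩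
  obtain ⟨a, ha⟩ : ∃ a, a = t + b := ⟨_, rfl⟩
  have hs' : s = a + b := by linear_combination hb - ha
  have ht' : t = a - b := by linear_combination -ha
  subst hs' ht'
  have hab : a * b = -u := by
    apply mul_left_cancel₀ two0; apply mul_left_cancel₀ two0
    linear_combination ht - hs
  have coab : IsCoprime a b := by
    rw [hs, ht] at co
    obtain ⟨p, q, hpq⟩ := (IsCoprime.pow_iff two_pos two_pos).1 co
    exact ⟨p + q, p - q, by linear_combination hpq⟩
  have heq : a^4+6*a^2*b^2+b^4 = (x^2-2*u)^2 := by
    apply mul_left_cancel₀ two0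
    have e1 : 2*(a^4+6*a^2*b^2+b^4) = ((a+b)^2)^2 + ((a-b)^2)^2 := by ring
    rw [e1, ← hs, ← ht]
    linear_combination -2 * x^2 * hu
  have : a * b = 0 := by
    by_cases hbe : (1+gI) ∣ b
    · rw [even_case coab hbe heq, mul_zero]
    · have hae : (1+gI) ∣ a := by
        by_contra h
        exact hso (odd_add_odd h hbe)
      rw [even_case coab.symm hae (by rw [← heq]; ring), zero_mul]
  rw [this] at hab
  linear_combination hab

open Zsqrtd

/-- If `x, y, z` are Gaussian integers with `x * y * z ≠ 0`, `gcd (x, y)` a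
unit, `x * y` not divisible by `1 + i`, and `x⁴ + 6x²y² + y⁴ = z²`, then
`x² + y² = 0`. -/
theorem mordell_odd_case (x y z : GaussianInt) (hxyz : x * y * z ≠ 0)
    (hgcd : ∀ d : GaussianInt, d ∣ x → d ∣ y → IsUnit d)
    (hodd : ¬ (1 + sqrtd) ∣ (x * y))
    (heq : x ^ 4 + 6 * x ^ 2 * y ^ 2 + y ^ 4 = z ^ 2) :
    x ^ 2 + y ^ 2 = 0 := by
  have hodd' : ¬ (1+gI) ∣ x * y := hodd
  have hx : ¬ (1+gI) ∣ x := fun h => hodd' (h.mul_right _)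
  have hy : ¬ (1+gI) ∣ y := fun h => hodd' (h.mul_left _)
  have hc : IsCoprime x y := by
    rw [← EuclideanDomain.gcd_isUnit_iff]
    exact hgcd _ (EuclideanDomain.gcd_dvd_left x y) (EuclideanDomain.gcd_dvd_right x y)
  have hIu : IsUnit gI := IsUnit.of_mul_eq_one (-gI) (by linear_combination -gI_sq)
  have two0 : (2:GaussianInt) ≠ 0 := by decide
  have good : ∀ u, x^2 + y^2 = 4*u → x^2 + y^2 = 0 := by
    intro u hu
    have hY : ¬ (1+gI) ∣ gI * y := by
      intro h; exact (l_prime.dvd_or_dvd h).elim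
        (fun h => l_prime.not_isUnit (isUnit_of_dvd_unit h hIu)) hy
    have := odd_twist (x := x) (Y := gI*y) (z := z) (u := u)
      ((isCoprime_mul_unit_left_right hIu x y).2 hc) hx hY
      (by linear_combination heq + (-6*x^2*y^2 + y^4*(gI^2-1))*gI_sq)
      (by linear_combination hu - y^2*gI_sq)
    rw [hu, this, mul_zero]
  have bad : ∀ u, x^2 - y^2 = 4*u → False := by
    intro u hu
    obtain ⟨t, ht⟩ := odd_sq hodd'
    have hz : z^2 = 8*(2*u^2 + x^2*y^2) := by
      linear_combination -heq + (x^2-y^2+4*u)*hu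
    have h4 : (2:GaussianInt)^2 ∣ z^2 := ⟨2*(2*u^2 + x^2*y^2), by linear_combination hz⟩
    obtain ⟨w, rfl⟩ := pow_dvd_aux two_ne_zero h4
    have hw : w^2 = 2*(2*u^2 + x^2*y^2) := by
      apply mul_left_cancel₀ two0; apply mul_left_cancel₀ two0
      linear_combination hz
    have hwe : (1+gI) ∣ w := by
      apply l_prime.dvd_of_dvd_pow (n := 2)
      rw [hw]; exact two_even.mul_right _
    obtain ⟨v, rfl⟩ := hwe
    have hv : gI * v^2 = 2*u^2 + x^2*y^2 := by
      apply mul_left_cancel₀ two0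
      linear_combination hw - v^2*gI_sq
    have hvo : ¬ (1+gI) ∣ v := by
      intro h
      have h1 : (1+gI) ∣ (x*y)^2 := by
        have h2 : (1+gI) ∣ gI*v^2 - 2*u^2 :=
          dvd_sub ((dvd_pow h two_ne_zero).mul_left _) (two_even.mul_right _)
        rw [hv] at h2
        convert h2 using 1; ring
      exact hodd' (l_prime.dvd_of_dvd_pow h1)
    obtain ⟨r, hr⟩ := odd_sq hvo
    exact n1' ⟨u^2 + t - gI * r, by linear_combination hv + ht - gI*hr⟩
  rcases odd_sq4 hx with ⟨t, ht⟩ | ⟨t, ht⟩ <;> rcases odd_sq4 hy with ⟨v, hv⟩ | ⟨v, hv⟩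
  · exact (bad (t - v) (by linear_combination ht - hv)).elim
  · exact good (t + v) (by linear_combination ht + hv)
  · exact good (t + v) (by linear_combination ht + hv)
  · exact (bad (t - v) (by linear_combination ht - hv)).elim
end
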